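/- arXiv:1010.3353 — 5 statements merged into one kernel-verified Lean document; each statement's English description precedes it below -/
import Mathlib

section
/- (Discrete Sobolev inequality.) Let d ≥ 1 and γ > 1 with γ(d−2) < d. There exists a constant c = c_{d,γ} > 0 such that for every probability measure p on ℤ^d, Σ_{z∈ℤ^d} p(z)^γ ≤ c · S(p)^{d(γ−1)/2}. -/
open MeasureTheory Filter
open scoped ENNReal NNReal Topology

/-- The lattice `ℤ^d`. -/
abbrev Zd (d : ℕ) := Fin d → ℤ

/-- Real power with the convention `0 ^ 0 = 0`. -/
noncomputable def mpow (x γ : ℝ) : ℝ := if x = 0 then 0 else x ^ γ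

/-- `p` is a probability measure on `ℤ^d`, identified with its mass function. -/
def IsProb {d : ℕ} (p : Zd d → ℝ) : Prop := (∀ z, 0 ≤ p z) ∧ HasSum p 1

/-- The discrete Dirichlet form `S(p) = -(Δ√p, √p)`, with values in `[0,∞]`. -/
noncomputable def dirS {d : ℕ} (p : Zd d → ℝ) : ℝ≥0∞ :=
  2⁻¹ * ∑' z : Zd d, ∑' x : Zd d,
    if (∑ i, |x i - z i|) = 1 then
      ENNReal.ofReal ((Real.sqrt (p x) - Real.sqrt (p z)) ^ 2) else 0

/-- The functional whose infimum is `χ^{DB}_γ(ρ)`. -/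
noncomputable def FDB {d : ℕ} (γ ρ : ℝ) (p : Zd d → ℝ) : ℝ≥0∞ :=
  dirS p + ∑' z : Zd d, ENNReal.ofReal (ρ / (1 - γ) * (mpow (p z) γ - p z))

noncomputable def chiDB (d : ℕ) (γ ρ : ℝ) : ℝ≥0∞ :=
  ⨅ p : {p : Zd d → ℝ // IsProb p}, FDB γ ρ p.1

/-- The functional whose infimum is `χ^{DE}(ρ)`. -/
noncomputable def FDE {d : ℕ} (ρ : ℝ) (p : Zd d → ℝ) : ℝ≥0∞ :=
  dirS p + ∑' z : Zd d, ENNReal.ofReal (-(ρ * (p z * Real.log (p z))))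

noncomputable def chiDE (d : ℕ) (ρ : ℝ) : ℝ≥0∞ :=
  ⨅ p : {p : Zd d → ℝ // IsProb p}, FDE ρ p.1

/-- Admissible test functions: smooth, compactly supported, `L²`-normalised. -/
def TestFun (d : ℕ) (g : EuclideanSpace ℝ (Fin d) → ℝ) : Prop :=
  ContDiff ℝ (⊤ : ℕ∞) g ∧ HasCompactSupport g ∧ ∫ x, (g x) ^ 2 = 1

noncomputable def chiAB (d : ℕ) (ρ : ℝ) : ℝ :=
  sInf {v : ℝ | ∃ g : EuclideanSpace ℝ (Fin d) → ℝ, TestFun d g ∧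
    v = ∫ x, ‖fderiv ℝ g x‖ ^ 2 - ρ * ∫ x, (g x) ^ 2 * Real.log ((g x) ^ 2)}

noncomputable def chiB (d : ℕ) (γ ρ : ℝ) : ℝ :=
  sInf {v : ℝ | ∃ g : EuclideanSpace ℝ (Fin d) → ℝ, TestFun d g ∧
    v = ∫ x, ‖fderiv ℝ g x‖ ^ 2 + ρ / (1 - γ) * ∫ x, (mpow ((g x) ^ 2) γ - (g x) ^ 2)}

noncomputable def chiRWRS (d : ℕ) (H : ℝ → ℝ) (θ : ℝ) : ℝ :=
  sInf {v : ℝ | ∃ g : EuclideanSpace ℝ (Fin d) → ℝ, TestFun d g ∧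
    v = ∫ x, ‖fderiv ℝ g x‖ ^ 2 - θ * ∫ x, H ((g x) ^ 2)}

/-- `f` is regularly varying (at infinity) with index `idx`. -/
def RegVary (f : ℝ → ℝ) (idx : ℝ) : Prop :=
  ∀ y : ℝ, 0 < y → Tendsto (fun t => f (t * y) / f t) atTop (𝓝 (y ^ idx))

noncomputable def hatH (γ y : ℝ) : ℝ :=
  if γ = 1 then y * Real.log y else (y - mpow y γ) / (1 - γ)

/-- Assumption (H) of the paper. -/
structure AssumptionH (H : ℝ → ℝ) (γ ρ : ℝ) (khat : ℝ → ℝ) : Prop where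
  hγ : 0 ≤ γ
  hρ : 0 < ρ
  khat_pos : ∀ t, 0 < t → 0 < khat t
  khat_cont : ContinuousOn khat (Set.Ioi 0)
  khat_rv : RegVary khat γ
  conv : ∀ K : Set ℝ, IsCompact K → K ⊆ Set.Ici 0 →
    TendstoUniformlyOn (fun t y => (H (t * y) - y * H t) / khat t)
      (fun y => ρ * hatH γ y) atTop K

/-- The discrete Laplacian on `ℤ^d`. -/
noncomputable def discLap {d : ℕ} (f : Zd d → ℝ) (z : Zd d) : ℝ :=
  ∑ i : Fin d,
    ((f (fun j => z j + if j = i then 1 else 0) - f z) +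
     (f (fun j => z j - if j = i then 1 else 0) - f z))

/-- `u` is a nonnegative solution of the PAM equation with diffusion constant `κt`,
potential `ξ` and localised initial condition. -/
def IsSolPAM {d : ℕ} (κt : ℝ) (ξ : Zd d → ℝ) (u : ℝ → Zd d → ℝ) : Prop :=
  (∀ s z, 0 ≤ u s z) ∧
  (∀ z, u 0 z = if z = 0 then 1 else 0) ∧
  (∀ s, 0 < s → ∀ z,
    HasDerivAt (fun s' => u s' z) (κt * discLap (fun x => u s x) z + ξ z * u s z) s)

/-- `u` is the minimal nonnegative solution. -/
def MinimalSol {d : ℕ} (κt : ℝ) (ξ : Zd d → ℝ) (u : ℝ → Zd d → ℝ) : Prop :=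
  IsSolPAM κt ξ u ∧ ∀ v, IsSolPAM κt ξ v → ∀ s z, u s z ≤ v s z

theorem edist_rpow_le {s : ℝ} (hs : 1 ≤ s) {a b : ℝ} (ha : 0 ≤ a) (hb : 0 ≤ b) :
    edist (a ^ s) (b ^ s) ≤
      ENNReal.ofReal s * (ENNReal.ofReal a ^ (s - 1) + ENNReal.ofReal b ^ (s - 1)) * edist a b := by
  have key : ∀ {a b : ℝ}, 0 ≤ b → b ≤ a → a ^ s - b ^ s ≤ s * a ^ (s - 1) * (a - b) := by
    intro a b hb hab
    rcases hb.eq_or_lt with rfl | hb'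
    · rcases hab.eq_or_lt with rfl | ha
      · simp
      · have : a ^ s = a ^ (s - 1) * a := by
          rw [← Real.rpow_add_one ha.ne']; congr 1; ring
        rw [Real.zero_rpow (by linarith), this]
        nlinarith [mul_nonneg (Real.rpow_nonneg ha.le (s - 1)) ha.le]
    · have ha : 0 < a := hb'.trans_le hab
      have hB := one_add_mul_self_le_rpow_one_add (s := b / a - 1)
        (by linarith [div_nonneg hb ha.le]) hs
      rw [add_sub_cancel, Real.div_rpow hb ha.le, le_div_iff₀ (by positivity)] at hB
      have : a ^ s = a ^ (s - 1) * a := by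
        rw [← Real.rpow_add_one ha.ne']; congr 1; ring
      have h2 : (1 + s * (b / a - 1)) * a ^ s = a ^ s - s * a ^ (s - 1) * (a - b) := by
        rw [this]; field_simp; ring
      linarith
  have real : |a ^ s - b ^ s| ≤ s * (a ^ (s - 1) + b ^ (s - 1)) * |a - b| := by
    have h1 := Real.rpow_nonneg ha (s - 1)
    have h2 := Real.rpow_nonneg hb (s - 1)
    rcases le_total b a with h | h
    · rw [abs_of_nonneg (sub_nonneg.2 (Real.rpow_le_rpow hb h (by linarith))),
        abs_of_nonneg (sub_nonneg.2 h)]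
      have := mul_nonneg (mul_nonneg (by linarith : 0 ≤ s) h2) (sub_nonneg.2 h)
      nlinarith [key hb h]
    · rw [abs_sub_comm, abs_sub_comm a,
        abs_of_nonneg (sub_nonneg.2 (Real.rpow_le_rpow ha h (by linarith))),
        abs_of_nonneg (sub_nonneg.2 h)]
      have := mul_nonneg (mul_nonneg (by linarith : 0 ≤ s) h1) (sub_nonneg.2 h)
      nlinarith [key ha h]
  rw [edist_dist, edist_dist, Real.dist_eq, Real.dist_eq,
    ENNReal.ofReal_rpow_of_nonneg ha (by linarith), ENNReal.ofReal_rpow_of_nonneg hb (by linarith),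
    ← ENNReal.ofReal_add (by positivity) (by positivity), ← ENNReal.ofReal_mul (by linarith),
    ← ENNReal.ofReal_mul (by positivity)]
  exact ENNReal.ofReal_le_ofReal real

/-- A function on `ℤ` vanishing at infinity is bounded by its total variation. -/
theorem ofReal_le_tsum_edist_succ {g : ℤ → ℝ} (hg : Tendsto g cofinite (𝓝 0)) (a : ℤ) :
    ENNReal.ofReal (g a) ≤ ∑' k : ℤ, edist (g (k + 1)) (g k) := by
  have hinj : Function.Injective fun n : ℕ => a + (n : ℤ) := fun m n h => by simpa using h
  have hlim : Tendsto (fun n : ℕ => g (a + n)) atTop (𝓝 0) := by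
    rw [← Nat.cofinite_eq_atTop]
    exact hg.comp hinj.tendsto_cofinite
  have h := edist_le_tsum_of_edist_le_of_tendsto₀
    (fun n : ℕ => edist (g (a + n + 1)) (g (a + n)))
    (fun n => by rw [edist_comm]; simp [add_assoc]) hlim
  calc ENNReal.ofReal (g a) ≤ edist (g (a + (0 : ℕ))) 0 := by
        rw [edist_dist, Real.dist_eq]
        exact ENNReal.ofReal_le_ofReal (by simpa using le_abs_self (g a))
    _ ≤ _ := h
    _ ≤ _ := ENNReal.tsum_comp_le_tsum_of_injective hinj (fun k => edist (g (k + 1)) (g k))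

theorem pi_count_eq_count (d : ℕ) :
    Measure.pi (fun _ : Fin d => (Measure.count : Measure ℤ)) = Measure.count :=
  Measure.ext_of_singleton fun x => by simp [Measure.pi_singleton]

/-- The nearest neighbour of `x` in the positive `i`-th direction. -/
def latticeStep {d : ℕ} (i : Fin d) (x : Zd d) : Zd d := Function.update x i (x i + 1)

theorem latticeStep_injective {d : ℕ} (i : Fin d) : Function.Injective (latticeStep i) := by
  intro x y h
  ext j
  have hj := congrFun h j
  by_cases hji : j = i
  · subst hji; simpa [latticeStep] using hj
  · simpa [latticeStep, hji] using hj

/-- The `ℓ¹`-norm of the forward gradient of `u` at `x`. -/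
noncomputable def gradSum {d : ℕ} (u : Zd d → ℝ) (x : Zd d) : ℝ≥0∞ :=
  ∑ i, edist (u (latticeStep i x)) (u x)

theorem ofReal_le_lintegral_gradSum {d : ℕ} {u : Zd d → ℝ} (hu : Tendsto u cofinite (𝓝 0))
    (x : Zd d) (i : Fin d) :
    ENNReal.ofReal (u x) ≤ ∫⁻ k, gradSum u (Function.update x i k) ∂Measure.count := by
  rw [lintegral_count]
  have h := ofReal_le_tsum_edist_succ (hu.comp (Function.update_injective x i).tendsto_cofinite)
    (x i)
  simp only [Function.comp_apply, Function.update_eq_self] at h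
  refine h.trans (ENNReal.tsum_le_tsum fun k => ?_)
  have := Finset.single_le_sum (s := Finset.univ)
    (f := fun j => edist (u (latticeStep j (Function.update x i k))) (u (Function.update x i k)))
    (fun _ _ => zero_le) (Finset.mem_univ i)
  simpa [gradSum, latticeStep] using this

theorem ofReal_le_tsum_gradSum {d : ℕ} {u : Zd d → ℝ} (hu : Tendsto u cofinite (𝓝 0))
    (x : Zd d) (i : Fin d) : ENNReal.ofReal (u x) ≤ ∑' y, gradSum u y := by
  refine (ofReal_le_lintegral_gradSum hu x i).trans ?_
  rw [lintegral_count]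
  exact ENNReal.tsum_comp_le_tsum_of_injective (Function.update_injective x i) (gradSum u)

/-- The discrete Gagliardo–Nirenberg inequality for `ℓ¹`-gradients. -/
theorem tsum_ofReal_rpow_le_tsum_gradSum {d : ℕ} {u : Zd d → ℝ} (hu : Tendsto u cofinite (𝓝 0))
    {α : ℝ} (hα : Real.HolderConjugate d α) :
    ∑' x, ENNReal.ofReal (u x) ^ α ≤ (∑' x, gradSum u x) ^ α := by
  have h := lintegral_prod_lintegral_pow_le (fun _ : Fin d => (Measure.count : Measure ℤ))
    (p := α) (by simpa using hα) (f := gradSum u) (measurable_of_countable _)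
  rw [pi_count_eq_count, lintegral_count, lintegral_count] at h
  refine le_trans (ENNReal.tsum_le_tsum fun x => ?_) h
  have hd : (0 : ℝ) < d - 1 := by linarith [hα.lt]
  have hαd : α = (1 : ℝ) / (d - 1) * d := by
    rw [hα.conjugate_eq]; field_simp
  calc ENNReal.ofReal (u x) ^ α
      = ∏ _i : Fin d, ENNReal.ofReal (u x) ^ ((1 : ℝ) / (d - 1)) := by
        rw [Finset.prod_const, Finset.card_univ, Fintype.card_fin, ← ENNReal.rpow_natCast,
          ← ENNReal.rpow_mul, ← hαd]
    _ ≤ _ := by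
        rw [Fintype.card_fin]
        exact Finset.prod_le_prod' fun i _ =>
          ENNReal.rpow_le_rpow (ofReal_le_lintegral_gradSum hu x i) (by positivity)

theorem tsum_edist_sqrt_sq_le {d : ℕ} (p : Zd d → ℝ) (i : Fin d) :
    ∑' x, edist (√(p (latticeStep i x))) (√(p x)) ^ (2 : ℝ) ≤ 2 * dirS p := by
  rw [dirS, ← mul_assoc, ENNReal.mul_inv_cancel (by simp) (by simp), one_mul]
  refine ENNReal.tsum_le_tsum fun z => le_trans (le_of_eq ?_) (ENNReal.le_tsum (latticeStep i z))
  have h1 : ∑ j, |latticeStep i z j - z j| = 1 := by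
    rw [Finset.sum_eq_single i]
    · simp [latticeStep]
    · intro j _ hj; simp [latticeStep, hj]
    · simp
  rw [if_pos h1, edist_dist, Real.dist_eq, ENNReal.ofReal_rpow_of_nonneg (abs_nonneg _) (by simp),
    Real.rpow_two, sq_abs]

theorem tsum_gradSum_le {d : ℕ} {s : ℝ} (hs : 1 ≤ s) (p : Zd d → ℝ) (hp : ∀ z, 0 ≤ p z) :
    ∑' x, gradSum (fun z => √(p z) ^ s) x ≤
      (d * ENNReal.ofReal s * 4) * (∑' x, ENNReal.ofReal (p x) ^ (s - 1)) ^ (1 / 2 : ℝ) *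
        dirS p ^ (1 / 2 : ℝ) := by
  set N : ℝ≥0∞ := ∑' x, ENNReal.ofReal (p x) ^ (s - 1)
  set P : Zd d → ℝ≥0∞ := fun x => ENNReal.ofReal (√(p x)) ^ (s - 1) with hP
  have hPsq : ∀ x, P x ^ (2 : ℝ) = ENNReal.ofReal (p x) ^ (s - 1) := fun x => by
    rw [hP, ← ENNReal.rpow_mul, mul_comm, ENNReal.rpow_mul,
      ENNReal.ofReal_rpow_of_nonneg (Real.sqrt_nonneg _) (by simp), Real.rpow_two,
      Real.sq_sqrt (hp x)]
  have hCS : ∀ (i : Fin d) (F : Zd d → ℝ≥0∞), ∑' x, F x ^ (2 : ℝ) ≤ N →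
      ∑' x, F x * edist (√(p (latticeStep i x))) (√(p x)) ≤
        N ^ (1 / 2 : ℝ) * (2 * dirS p) ^ (1 / 2 : ℝ) := fun i F hF => by
    have h := ENNReal.lintegral_mul_le_Lp_mul_Lq (Measure.count : Measure (Zd d))
      Real.HolderConjugate.two_two
      (measurable_of_countable F).aemeasurable
      (measurable_of_countable
        (fun x => edist (√(p (latticeStep i x))) (√(p x)))).aemeasurable
    simp only [lintegral_count, Pi.mul_apply] at h
    exact h.trans (mul_le_mul' (ENNReal.rpow_le_rpow hF (by simp))
      (ENNReal.rpow_le_rpow (tsum_edist_sqrt_sq_le p i) (by simp)))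
  have hi : ∀ i : Fin d, ∑' x, edist (√(p (latticeStep i x)) ^ s) (√(p x) ^ s) ≤
      ENNReal.ofReal s * 4 * N ^ (1 / 2 : ℝ) * dirS p ^ (1 / 2 : ℝ) := fun i => by
    calc ∑' x, edist (√(p (latticeStep i x)) ^ s) (√(p x) ^ s)
        ≤ ∑' x, ENNReal.ofReal s * (P (latticeStep i x) *
            edist (√(p (latticeStep i x))) (√(p x)) +
              P x * edist (√(p (latticeStep i x))) (√(p x))) :=
          ENNReal.tsum_le_tsum fun x =>
            (edist_rpow_le hs (Real.sqrt_nonneg _) (Real.sqrt_nonneg _)).trans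
              (le_of_eq (by rw [hP]; ring))
      _ ≤ ENNReal.ofReal s * (N ^ (1 / 2 : ℝ) * (2 * dirS p) ^ (1 / 2 : ℝ) +
            N ^ (1 / 2 : ℝ) * (2 * dirS p) ^ (1 / 2 : ℝ)) := by
          rw [ENNReal.tsum_mul_left, ENNReal.tsum_add]
          gcongr
          · refine hCS i _ ?_
            simp only [hPsq]
            exact ENNReal.tsum_comp_le_tsum_of_injective (latticeStep_injective i)
              (fun x => ENNReal.ofReal (p x) ^ (s - 1))
          · exact hCS i _ (by simp only [hPsq]; exact le_rfl)
      _ = ENNReal.ofReal s * (2 * 2 ^ (1 / 2 : ℝ)) * N ^ (1 / 2 : ℝ) * dirS p ^ (1 / 2 : ℝ) := by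
          rw [ENNReal.mul_rpow_of_nonneg _ _ (by simp)]; ring
      _ ≤ ENNReal.ofReal s * 4 * N ^ (1 / 2 : ℝ) * dirS p ^ (1 / 2 : ℝ) := by
          gcongr
          calc (2 : ℝ≥0∞) * 2 ^ (1 / 2 : ℝ) ≤ 2 * 2 ^ (1 : ℝ) := by
                gcongr <;> norm_num
            _ = 4 := by norm_num
  simp only [gradSum]
  rw [Summable.tsum_finsetSum fun _ _ => ENNReal.summable]
  refine (Finset.sum_le_sum fun i _ => hi i).trans (le_of_eq ?_)
  rw [Finset.sum_const, Finset.card_univ, Fintype.card_fin, nsmul_eq_mul]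
  ring

/-- Log-convexity of `γ ↦ ∑ P ^ γ` for a probability mass function `P`. -/
theorem tsum_rpow_le_rpow {ι : Type*} [Countable ι] {P : ι → ℝ≥0∞} (hP : ∑' x, P x = 1) {β γ : ℝ}
    (hβ : 1 ≤ β) (hβγ : β ≤ γ) (hγ : 1 < γ) :
    ∑' x, P x ^ β ≤ (∑' x, P x ^ γ) ^ ((β - 1) / (γ - 1)) := by
  let _ : MeasurableSpace ι := ⊤
  have hγ' : 0 < γ - 1 := by linarith
  have hθ : 0 ≤ (β - 1) / (γ - 1) := div_nonneg (by linarith) hγ'.le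
  have hθ' : 0 ≤ 1 - (β - 1) / (γ - 1) := by
    rw [sub_nonneg, div_le_one hγ']; linarith
  have h := ENNReal.lintegral_mul_norm_pow_le (μ := Measure.count) (α := ι)
    (f := fun x => P x ^ γ) (g := P) (measurable_of_countable _).aemeasurable
    (measurable_of_countable _).aemeasurable hθ hθ' (by ring)
  simp only [lintegral_count, hP, ENNReal.one_rpow, mul_one] at h
  refine le_trans (le_of_eq (tsum_congr fun x => ?_)) h
  rw [← ENNReal.rpow_mul, ← ENNReal.rpow_add_of_nonneg _ _ (by positivity) hθ']
  congr 1
  field_simp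
  ring

theorem ENNReal.le_rpow_of_le_mul_rpow {N A : ℝ≥0∞} {t : ℝ} (hN : N ≠ ∞) (ht : t < 1)
    (h : N ≤ A * N ^ t) : N ≤ A ^ (1 - t)⁻¹ := by
  rcases eq_or_ne N 0 with rfl | hN0
  · exact zero_le
  have ht' : 0 < 1 - t := by linarith
  rw [ENNReal.le_rpow_inv_iff ht', ENNReal.rpow_sub _ _ hN0 hN, ENNReal.rpow_one]
  exact ENNReal.div_le_of_le_mul h

namespace IsProb

variable {d : ℕ} {p : Zd d → ℝ}

theorem tsum_ofReal (hp : IsProb p) : ∑' x, ENNReal.ofReal (p x) = 1 := by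
  rw [← ENNReal.ofReal_tsum_of_nonneg hp.1 hp.2.summable, hp.2.tsum_eq, ENNReal.ofReal_one]

theorem tendsto_sqrt_rpow (hp : IsProb p) {s : ℝ} (hs : 0 < s) :
    Tendsto (fun z => √(p z) ^ s) cofinite (𝓝 0) := by
  have h := ((Real.continuous_sqrt.tendsto 0).comp hp.2.summable.tendsto_cofinite_zero)
  rw [Real.sqrt_zero] at h
  simpa [hs.ne'] using h.rpow_const (p := s) (Or.inr hs.le)

theorem ofReal_sqrt_rpow (hp : IsProb p) {s : ℝ} (hs : 0 ≤ s) (x : Zd d) :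
    ENNReal.ofReal (√(p x) ^ s) = ENNReal.ofReal (p x) ^ (s / 2) := by
  rw [ENNReal.ofReal_rpow_of_nonneg (hp.1 x) (by positivity), Real.sqrt_eq_rpow,
    ← Real.rpow_mul (hp.1 x)]
  congr 2; ring

theorem tsum_rpow_ne_top (hp : IsProb p) {γ : ℝ} (hγ : 1 ≤ γ) :
    ∑' x, ENNReal.ofReal (p x) ^ γ ≠ ∞ := by
  refine ne_top_of_le_ne_top ENNReal.one_ne_top (hp.tsum_ofReal ▸ ENNReal.tsum_le_tsum fun x => ?_)
  have h1 : ENNReal.ofReal (p x) ≤ 1 := hp.tsum_ofReal ▸ ENNReal.le_tsum x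
  simpa using ENNReal.rpow_le_rpow_of_exponent_ge h1 hγ

end IsProb

/-- The Sobolev inequality for exponents at least `d / (d - 1)`. -/
theorem sobolev_of_conjExponent_le {d : ℕ} {α γ : ℝ} (hα : Real.HolderConjugate d α)
    (hαγ : α ≤ γ) (hγd : γ * ((d : ℝ) - 2) ≤ d) :
    ∃ K : ℝ≥0∞, K ≠ ∞ ∧ ∀ p : Zd d → ℝ, IsProb p →
      ∑' x, ENNReal.ofReal (p x) ^ γ ≤ K * dirS p ^ ((d : ℝ) * (γ - 1) / 2) := by
  have hd : (0 : ℝ) < d - 1 := by linarith [hα.lt]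
  have hα1 : 1 < α := hα.symm.lt
  have hα0 : 0 < α := by linarith
  have hγ1 : 1 < γ := by linarith
  have hαd : α * (d - 1) = d := by rw [hα.conjugate_eq]; field_simp
  set s := 2 * γ / α with hs
  have hsα : s * α = 2 * γ := by rw [hs]; field_simp
  have hs2 : 2 ≤ s := by rw [hs, le_div_iff₀ hα0]; linarith
  have hsγ : s - 1 ≤ γ := by
    rw [hs, sub_le_iff_le_add, div_le_iff₀ hα0]
    have : 2 * γ * (d - 1) ≤ (γ + 1) * α * (d - 1) := by
      rw [mul_assoc _ α, hαd]; linarith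
    exact le_of_mul_le_mul_right this hd
  set t := (s - 1 - 1) / (γ - 1) * (1 / 2 * α) with ht
  have hγ1' : γ - 1 ≠ 0 := by linarith
  have h1t : 1 - t = (α - 1) / (γ - 1) := by
    rw [ht]; field_simp; linarith
  have ht1 : t < 1 := by
    have : 0 < 1 - t := h1t ▸ div_pos (by linarith) (by linarith)
    linarith
  have hexp : 1 / 2 * α * (1 - t)⁻¹ = (d : ℝ) * (γ - 1) / 2 := by
    have : α - 1 ≠ 0 := by linarith
    rw [h1t]; field_simp; nlinarith
  set B : ℝ≥0∞ := d * ENNReal.ofReal s * 4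
  refine ⟨(B ^ α) ^ (1 - t)⁻¹, ?_, fun p hp => ?_⟩
  · have : 0 ≤ (1 - t)⁻¹ := inv_nonneg.2 (by linarith)
    finiteness
  have h := tsum_ofReal_rpow_le_tsum_gradSum (hp.tendsto_sqrt_rpow (s := s) (by linarith)) hα
  simp only [hp.ofReal_sqrt_rpow (s := s) (by linarith), ← ENNReal.rpow_mul] at h
  rw [show s / 2 * α = γ by linarith] at h
  set N := ∑' x, ENNReal.ofReal (p x) ^ γ
  have hNN : ∑' x, ENNReal.ofReal (p x) ^ (s - 1) ≤ N ^ ((s - 1 - 1) / (γ - 1)) :=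
    tsum_rpow_le_rpow hp.tsum_ofReal (by linarith) hsγ hγ1
  have hmain : N ≤ B ^ α * (dirS p ^ (1 / 2 * α)) * N ^ t := by
    calc N ≤ (B * (N ^ ((s - 1 - 1) / (γ - 1))) ^ (1 / 2 : ℝ) * dirS p ^ (1 / 2 : ℝ)) ^ α := by
          refine h.trans (ENNReal.rpow_le_rpow ?_ hα0.le)
          refine (tsum_gradSum_le (by linarith) p hp.1).trans ?_
          gcongr
      _ = _ := by
          rw [ENNReal.mul_rpow_of_nonneg _ _ hα0.le, ENNReal.mul_rpow_of_nonneg _ _ hα0.le,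
            ← ENNReal.rpow_mul, ← ENNReal.rpow_mul, ← ENNReal.rpow_mul, ← ht]
          ring
  refine (ENNReal.le_rpow_of_le_mul_rpow (hp.tsum_rpow_ne_top hγ1.le) ht1 hmain).trans ?_
  rw [ENNReal.mul_rpow_of_nonneg _ _ (inv_nonneg.2 (by linarith)), ← ENNReal.rpow_mul (dirS p),
    hexp]

/-- The Sobolev inequality on `ℤ`. -/
theorem sobolev_dim_one {γ : ℝ} (hγ : 1 < γ) :
    ∃ K : ℝ≥0∞, K ≠ ∞ ∧ ∀ p : Zd 1 → ℝ, IsProb p →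
      ∑' x, ENNReal.ofReal (p x) ^ γ ≤ K * dirS p ^ ((γ - 1) / 2) := by
  have hγ' : 0 ≤ γ - 1 := by linarith
  set B : ℝ≥0∞ := (1 : ℕ) * ENNReal.ofReal 2 * 4
  refine ⟨B ^ (γ - 1), ENNReal.rpow_ne_top_of_nonneg hγ' (by finiteness), fun p hp => ?_⟩
  have hsup : ∀ x, ENNReal.ofReal (p x) ≤ B * dirS p ^ (1 / 2 : ℝ) := fun x => by
    have h := (ofReal_le_tsum_gradSum (hp.tendsto_sqrt_rpow (s := 2) (by simp)) x 0).trans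
      (tsum_gradSum_le (by norm_num) p hp.1)
    rw [hp.ofReal_sqrt_rpow (by norm_num)] at h
    norm_num [hp.tsum_ofReal] at h
    norm_num [B]
    exact h
  calc ∑' x, ENNReal.ofReal (p x) ^ γ
      ≤ ∑' x, ENNReal.ofReal (p x) * (B * dirS p ^ (1 / 2 : ℝ)) ^ (γ - 1) := by
        refine ENNReal.tsum_le_tsum fun x => ?_
        calc ENNReal.ofReal (p x) ^ γ
            = ENNReal.ofReal (p x) * ENNReal.ofReal (p x) ^ (γ - 1) := by
              conv_lhs => rw [← add_sub_cancel 1 γ,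
                ENNReal.rpow_add_of_nonneg _ _ zero_le_one hγ', ENNReal.rpow_one]
          _ ≤ _ := by gcongr; exact hsup x
    _ = _ := by
        rw [ENNReal.tsum_mul_right, hp.tsum_ofReal, one_mul, ENNReal.mul_rpow_of_nonneg _ _ hγ',
          ← ENNReal.rpow_mul, one_div_mul_eq_div]

/-- The Sobolev inequality in `ℝ≥0∞`, including the critical exponent. -/
theorem sobolev_ennreal {d : ℕ} (hd : 1 ≤ d) {γ : ℝ} (hγ : 1 < γ)
    (hγd : γ * ((d : ℝ) - 2) ≤ d) :
    ∃ K : ℝ≥0∞, K ≠ ∞ ∧ ∀ p : Zd d → ℝ, IsProb p →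
      ∑' x, ENNReal.ofReal (p x) ^ γ ≤ K * dirS p ^ ((d : ℝ) * (γ - 1) / 2) := by
  obtain rfl | hd2 := hd.eq_or_lt
  · simpa using sobolev_dim_one hγ
  have hα := Real.HolderConjugate.conjExponent (p := (d : ℝ)) (by exact_mod_cast hd2)
  set α := Real.conjExponent d
  rcases le_total α γ with h | h
  · exact sobolev_of_conjExponent_le hα h hγd
  have hd1 : (0 : ℝ) < d - 1 := by linarith [hα.lt]
  have hα1 : 1 < α := hα.symm.lt
  have hαd : α * (d - 1) = d := by rw [hα.conjugate_eq]; field_simp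
  obtain ⟨K, hK, hKp⟩ := sobolev_of_conjExponent_le hα le_rfl (by nlinarith)
  have hθ : 0 ≤ (γ - 1) / (α - 1) := div_nonneg (by linarith) (by linarith)
  refine ⟨K ^ ((γ - 1) / (α - 1)), ENNReal.rpow_ne_top_of_nonneg hθ hK, fun p hp => ?_⟩
  refine (tsum_rpow_le_rpow hp.tsum_ofReal hγ.le h hα1).trans
    ((ENNReal.rpow_le_rpow (hKp p hp) hθ).trans (le_of_eq ?_))
  have : α - 1 ≠ 0 := by linarith
  rw [ENNReal.mul_rpow_of_nonneg _ _ hθ, ← ENNReal.rpow_mul]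
  congr 2
  field_simp

/-- **discrete Sobolev inequality.** For `γ > 1` with `γ(d−2) < d` there is a
constant `c > 0` with `Σ_z p(z)^γ ≤ c·S(p)^{d(γ−1)/2}` for every probability measure `p`. -/
theorem stmt13 (d : ℕ) (hd : 1 ≤ d) (γ : ℝ) (hγ : 1 < γ) (hγd : γ * ((d : ℝ) - 2) < d) :
    ∃ c : ℝ, 0 < c ∧ ∀ p : Zd d → ℝ, IsProb p →
      ENNReal.ofReal (∑' z : Zd d, p z ^ γ) ≤
        ENNReal.ofReal c * dirS p ^ ((d : ℝ) * (γ - 1) / 2) := by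
  obtain ⟨K, hK, hKp⟩ := sobolev_ennreal hd hγ hγd.le
  refine ⟨K.toReal + 1, by positivity, fun p hp => ?_⟩
  calc ENNReal.ofReal (∑' z, p z ^ γ) ≤ ∑' z, ENNReal.ofReal (p z) ^ γ := by
        simp only [ENNReal.ofReal_rpow_of_nonneg (hp.1 _) (by linarith : 0 ≤ γ)]
        by_cases h : Summable fun z => p z ^ γ
        · exact (ENNReal.ofReal_tsum_of_nonneg (fun z => Real.rpow_nonneg (hp.1 z) γ) h).le
        · simp [tsum_eq_zero_of_not_summable h]
    _ ≤ K * dirS p ^ ((d : ℝ) * (γ - 1) / 2) := hKp p hp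
    _ ≤ _ := by
        gcongr
        rw [← ENNReal.ofReal_toReal hK]
        exact ENNReal.ofReal_le_ofReal (by simp)
end

section
/- Let d ≥ 1 and let g : ℝ^d → [0,∞) be smooth and compactly supported with ∫_{ℝ^d} g² = 1. For ε > 0 define the probability measure p_ε on ℤ^d by p_ε(z) := ∫_{εz + [0,ε)^d} g(x)² dx. Then lim_{ε↓0} ε^{−2}·S(p_ε) = ∫_{ℝ^d} |∇g|². -/
open MeasureTheory Filter
open scoped ENNReal NNReal Topology

section LatticeSums

lemma sum_abs_eq_one_iff {ι : Type*} [Fintype ι] [DecidableEq ι] (w : ι → ℤ) :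
    ∑ i, |w i| = 1 ↔ ∃ i, w = Pi.single i 1 ∨ w = Pi.single i (-1) := by
  constructor
  · intro h
    obtain ⟨i, hi⟩ : ∃ i, w i ≠ 0 := by
      by_contra! h0
      simp [h0] at h
    have hsplit := Finset.add_sum_erase Finset.univ (fun j => |w j|) (Finset.mem_univ i)
    have hrest : 0 ≤ ∑ j ∈ Finset.univ.erase i, |w j| :=
      Finset.sum_nonneg fun j _ => abs_nonneg _
    have hpos : 1 ≤ |w i| := Int.one_le_abs hi
    have hzero : ∑ j ∈ Finset.univ.erase i, |w j| = 0 := by omega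
    have hone : |w i| = 1 := by omega
    rw [Finset.sum_eq_zero_iff_of_nonneg fun j _ => abs_nonneg _] at hzero
    have hw : w = Pi.single i (w i) := by
      ext j
      by_cases hj : j = i
      · subst hj; simp
      · simpa [hj] using hzero j (by simp [hj])
    refine ⟨i, ?_⟩
    rcases (abs_eq zero_le_one).1 hone with h1 | h1 <;> rw [h1] at hw
    · exact Or.inl hw
    · exact Or.inr hw
  · rintro ⟨i, rfl | rfl⟩
    · rw [Finset.sum_eq_single i] <;> simp +contextual
    · rw [Finset.sum_eq_single i] <;> simp +contextual

lemma tsum_ite_sum_abs_eq_one {d : ℕ} (f : Zd d → ℝ≥0∞) :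
    ∑' w : Zd d, (if ∑ i, |w i| = 1 then f w else 0) =
      ∑ i, (f (Pi.single i 1) + f (Pi.single i (-1))) := by
  let φ : Fin d × Bool → Zd d := fun q => Pi.single q.1 (if q.2 then 1 else -1)
  have hφ : Function.Injective φ := by
    rintro ⟨i, b⟩ ⟨j, c⟩ h
    have hi := congrFun h i
    have hij : i = j := by
      by_contra hne
      simp only [φ, Pi.single_eq_same, Pi.single_eq_of_ne hne] at hi
      split_ifs at hi; simp at hi
    subst hij
    cases b <;> cases c <;> simp [φ] at hi ⊢
  have hsupp : Function.support (fun w : Zd d => if ∑ i, |w i| = 1 then f w else 0) ⊆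
      Set.range φ := by
    intro w hw
    have hw1 : ∑ i, |w i| = 1 := by
      by_contra hne
      simp [hne] at hw
    obtain ⟨i, rfl | rfl⟩ := (sum_abs_eq_one_iff w).1 hw1
    · exact ⟨(i, true), by simp [φ]⟩
    · exact ⟨(i, false), by simp [φ]⟩
  rw [← hφ.tsum_eq hsupp, tsum_fintype, Fintype.sum_prod_type]
  refine Finset.sum_congr rfl fun i _ => ?_
  rw [Fintype.sum_bool]
  simp only [φ, (sum_abs_eq_one_iff _).2 ⟨i, Or.inl rfl⟩,
    (sum_abs_eq_one_iff _).2 ⟨i, Or.inr rfl⟩, if_true, Bool.false_eq_true, if_false]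

lemma dirS_eq_sum_tsum {d : ℕ} (p : Zd d → ℝ) :
    dirS p = ∑ i, ∑' z : Zd d,
      ENNReal.ofReal ((Real.sqrt (p (z + Pi.single i 1)) - Real.sqrt (p z)) ^ 2) := by
  have hinner (z : Zd d) : (∑' x : Zd d, if (∑ i, |x i - z i|) = 1 then
        ENNReal.ofReal ((Real.sqrt (p x) - Real.sqrt (p z)) ^ 2) else 0) =
      ∑ i, (ENNReal.ofReal ((Real.sqrt (p (z + Pi.single i 1)) - Real.sqrt (p z)) ^ 2) +
        ENNReal.ofReal ((Real.sqrt (p (z + Pi.single i (-1))) - Real.sqrt (p z)) ^ 2)) := by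
    rw [← (Equiv.addLeft z).tsum_eq, ← tsum_ite_sum_abs_eq_one
      (fun w => ENNReal.ofReal ((Real.sqrt (p (z + w)) - Real.sqrt (p z)) ^ 2))]
    simp
  have hback (i : Fin d) : (∑' z : Zd d,
        ENNReal.ofReal ((Real.sqrt (p (z + Pi.single i (-1))) - Real.sqrt (p z)) ^ 2)) =
      ∑' z : Zd d,
        ENNReal.ofReal ((Real.sqrt (p (z + Pi.single i 1)) - Real.sqrt (p z)) ^ 2) := by
    rw [← (Equiv.addRight (Pi.single i 1 : Zd d)).tsum_eq]
    refine tsum_congr fun z => ?_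
    have hz : z + Pi.single i 1 + Pi.single i (-1) = z := by
      rw [add_assoc, ← Pi.single_add]; simp
    rw [Equiv.coe_addRight, hz, ← neg_sq, neg_sub]
  simp only [dirS, hinner]
  rw [Summable.tsum_finsetSum fun _ _ => ENNReal.summable, Finset.mul_sum]
  refine Finset.sum_congr rfl fun i _ => ?_
  rw [ENNReal.tsum_add, hback, ← two_mul, ← mul_assoc,
    ENNReal.inv_mul_cancel two_ne_zero ENNReal.ofNat_ne_top, one_mul]

end LatticeSums

section SquareMeans

variable {α : Type*} [MeasurableSpace α] {μ : Measure α} [IsFiniteMeasure μ]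

lemma sq_integral_le_measure_mul_integral_sq {f : α → ℝ} (hf : Integrable f μ)
    (hf2 : Integrable (fun x => f x ^ 2) μ) :
    (∫ x, f x ∂μ) ^ 2 ≤ μ.real Set.univ * ∫ x, f x ^ 2 ∂μ := by
  set V := μ.real Set.univ with hV
  set I := ∫ x, f x ∂μ with hI
  have hV0 : 0 ≤ V := measureReal_nonneg
  rcases hV0.eq_or_lt with h0 | hVpos
  · have hμ : μ = 0 := by
      rw [← Measure.measure_univ_eq_zero]
      simpa [hV, measureReal_def, ENNReal.toReal_eq_zero_iff] using h0.symm
    simp [hI, hμ]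
  have hnn : 0 ≤ ∫ x, (V * f x - I) ^ 2 ∂μ := integral_nonneg fun x => sq_nonneg _
  have hexp : ∫ x, (V * f x - I) ^ 2 ∂μ = V * (V * ∫ x, f x ^ 2 ∂μ - I ^ 2) := by
    have hfun : (fun x => (V * f x - I) ^ 2) =
        fun x => V ^ 2 * f x ^ 2 - 2 * V * I * f x + I ^ 2 := by
      ext x; ring
    have hlin : Integrable (fun x => V ^ 2 * f x ^ 2 - 2 * V * I * f x) μ :=
      (hf2.const_mul _).sub (hf.const_mul _)
    rw [hfun, integral_add hlin (integrable_const _),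
      integral_sub (hf2.const_mul _) (hf.const_mul _), integral_const_mul, integral_const_mul,
      integral_const, smul_eq_mul, ← hV, ← hI]
    ring
  rw [hexp] at hnn
  linarith [nonneg_of_mul_nonneg_right hnn hVpos]

lemma sqrt_integral_sq_le_add {a b : α → ℝ} {K : ℝ} (hK : 0 ≤ K) (ha : Integrable a μ)
    (ha2 : Integrable (fun x => a x ^ 2) μ) (hb2 : Integrable (fun x => b x ^ 2) μ)
    (hb0 : ∀ᵐ x ∂μ, 0 ≤ b x) (hab : ∀ᵐ x ∂μ, b x ≤ a x + K) :
    Real.sqrt (∫ x, b x ^ 2 ∂μ) ≤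
      Real.sqrt (∫ x, a x ^ 2 ∂μ) + K * Real.sqrt (μ.real Set.univ) := by
  set V := μ.real Set.univ with hV
  set A := ∫ x, a x ^ 2 ∂μ with hA
  have hV0 : 0 ≤ V := measureReal_nonneg
  have hA0 : 0 ≤ A := integral_nonneg fun x => sq_nonneg _
  have hI : ∫ x, a x ∂μ ≤ Real.sqrt V * Real.sqrt A := by
    rw [← Real.sqrt_mul hV0]
    exact Real.le_sqrt_of_sq_le (sq_integral_le_measure_mul_integral_sq ha ha2)
  refine Real.sqrt_le_iff.2 ⟨by positivity, ?_⟩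
  have hlin : Integrable (fun x => a x ^ 2 + 2 * K * a x) μ := ha2.add (ha.const_mul _)
  calc ∫ x, b x ^ 2 ∂μ ≤ ∫ x, (a x ^ 2 + 2 * K * a x + K ^ 2) ∂μ := by
        refine integral_mono_ae hb2 (hlin.add (integrable_const _)) ?_
        filter_upwards [hb0, hab] with x h0 h1
        nlinarith
    _ = A + 2 * K * ∫ x, a x ∂μ + V * K ^ 2 := by
        rw [integral_add hlin (integrable_const _),
          integral_add ha2 (ha.const_mul _), integral_const_mul, integral_const, smul_eq_mul]
    _ ≤ A + 2 * K * (Real.sqrt V * Real.sqrt A) + V * K ^ 2 := by gcongr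
    _ = (Real.sqrt A + K * Real.sqrt V) ^ 2 := by
        nlinarith [Real.sq_sqrt hA0, Real.sq_sqrt hV0]

/-- Reverse triangle inequality in `L²` for nonnegative functions at uniform distance `K`. -/
lemma abs_sqrt_integral_sq_sub_le {a b : α → ℝ} {K : ℝ} (hK : 0 ≤ K) (ha : Integrable a μ)
    (hb : Integrable b μ) (ha2 : Integrable (fun x => a x ^ 2) μ)
    (hb2 : Integrable (fun x => b x ^ 2) μ) (ha0 : ∀ᵐ x ∂μ, 0 ≤ a x) (hb0 : ∀ᵐ x ∂μ, 0 ≤ b x)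
    (hab : ∀ᵐ x ∂μ, |b x - a x| ≤ K) :
    |Real.sqrt (∫ x, b x ^ 2 ∂μ) - Real.sqrt (∫ x, a x ^ 2 ∂μ)| ≤
      K * Real.sqrt (μ.real Set.univ) := by
  have h1 := sqrt_integral_sq_le_add hK ha ha2 hb2 hb0
    (hab.mono fun x hx => by linarith [(abs_le.1 hx).2])
  have h2 := sqrt_integral_sq_le_add hK hb hb2 ha2 ha0
    (hab.mono fun x hx => by linarith [(abs_le.1 hx).1])
  rw [abs_le]
  constructor <;> linarith

end SquareMeans

section LatticeCubes

variable {d : ℕ}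

/-- The half-open cube `εz + [0, ε)^d`. -/
def latticeCube (ε : ℝ) (z : Zd d) : Set (EuclideanSpace ℝ (Fin d)) :=
  {x | ∀ i, ε * (z i : ℝ) ≤ x i ∧ x i < ε * (z i : ℝ) + ε}

/-- The index of the cube of side `ε` containing `x`. -/
noncomputable def latticeCell (ε : ℝ) (x : EuclideanSpace ℝ (Fin d)) : Zd d :=
  fun i => ⌊x i / ε⌋

lemma mem_latticeCube_iff {ε : ℝ} (hε : 0 < ε) {z : Zd d} {x : EuclideanSpace ℝ (Fin d)} :
    x ∈ latticeCube ε z ↔ latticeCell ε x = z := by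
  simp only [latticeCube, Set.mem_ofPred_eq, latticeCell, funext_iff, Int.floor_eq_iff]
  refine forall_congr' fun i => ?_
  rw [le_div_iff₀ hε, div_lt_iff₀ hε, add_mul, one_mul, mul_comm]

lemma measurable_latticeCell (ε : ℝ) : Measurable (latticeCell (d := d) ε) := by
  refine measurable_pi_lambda _ fun i => Int.measurable_floor.comp ?_
  fun_prop

lemma measurableSet_latticeCube {ε : ℝ} (hε : 0 < ε) (z : Zd d) :
    MeasurableSet (latticeCube ε z) := by
  have h : latticeCube ε z = latticeCell ε ⁻¹' {z} := by
    ext x; exact mem_latticeCube_iff hε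
  rw [h]
  exact measurable_latticeCell ε (measurableSet_singleton z)

lemma volume_latticeCube {ε : ℝ} (hε : 0 < ε) (z : Zd d) :
    volume (latticeCube ε z) = ENNReal.ofReal (ε ^ d) := by
  have h : latticeCube ε z = WithLp.ofLp ⁻¹'
      (Set.univ.pi fun i => Set.Ico (ε * (z i : ℝ)) (ε * (z i : ℝ) + ε)) := by
    ext x; simp [latticeCube]
  rw [h, (PiLp.volume_preserving_ofLp (Fin d)).measure_preimage
    (MeasurableSet.univ_pi fun i => measurableSet_Ico).nullMeasurableSet, Real.volume_pi_Ico]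
  simp [ENNReal.ofReal_pow hε.le]

lemma dist_le_of_mem_latticeCube {ε : ℝ} (hε : 0 < ε) {z : Zd d}
    {x y : EuclideanSpace ℝ (Fin d)} (hx : x ∈ latticeCube ε z) (hy : y ∈ latticeCube ε z) :
    dist y x ≤ d * ε := by
  rw [dist_eq_norm]
  refine (sq_le_sq₀ (norm_nonneg _) (by positivity)).1 ?_
  have hcoord (i : Fin d) : (y - x) i ^ 2 ≤ ε ^ 2 := by
    have h1 := hx i
    have h2 := hy i
    rw [PiLp.sub_apply]
    exact sq_le_sq' (by linarith) (by linarith)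
  calc ‖y - x‖ ^ 2 = ∑ i, (y - x) i ^ 2 := EuclideanSpace.real_norm_sq_eq _
    _ ≤ ∑ _i : Fin d, ε ^ 2 := Finset.sum_le_sum fun i _ => hcoord i
    _ = d * ε ^ 2 := by simp
    _ ≤ (d : ℝ) ^ 2 * ε ^ 2 := by
        gcongr
        exact_mod_cast Nat.le_self_pow two_ne_zero d
    _ = (d * ε) ^ 2 := by ring

lemma lintegral_comp_latticeCell {ε : ℝ} (hε : 0 < ε) (f : Zd d → ℝ≥0∞) :
    ∫⁻ x, f (latticeCell ε x) = ∑' z, ENNReal.ofReal (ε ^ d) * f z := by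
  have hcover : (⋃ z : Zd d, latticeCube ε z) = Set.univ :=
    Set.eq_univ_of_forall fun x => Set.mem_iUnion.2 ⟨_, (mem_latticeCube_iff hε).2 rfl⟩
  have hdisj : Pairwise (Function.onFun Disjoint (latticeCube (d := d) ε)) := fun z w hzw =>
    Set.disjoint_left.2 fun x hz hw =>
      hzw (((mem_latticeCube_iff hε).1 hz).symm.trans ((mem_latticeCube_iff hε).1 hw))
  rw [← setLIntegral_univ, ← hcover,
    lintegral_iUnion (fun z => measurableSet_latticeCube hε z) hdisj]
  refine tsum_congr fun z => ?_
  rw [setLIntegral_congr_fun (g := fun _ => f z) (measurableSet_latticeCube hε z)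
    fun x hx => by simp only [(mem_latticeCube_iff hε).1 hx], setLIntegral_const,
    volume_latticeCube hε, mul_comm]

lemma setIntegral_latticeCube_add_single (ε : ℝ) (z : Zd d) (i : Fin d)
    (f : EuclideanSpace ℝ (Fin d) → ℝ) :
    ∫ x in latticeCube ε (z + Pi.single i 1), f x =
      ∫ x in latticeCube ε z, f (x + ε • EuclideanSpace.single i 1) := by
  rw [← (measurePreserving_add_right volume
    (ε • EuclideanSpace.single i (1 : ℝ))).setIntegral_preimage_emb
    (measurableEmbedding_addRight _)]
  congr 2
  ext x
  simp only [latticeCube, Set.mem_preimage, Set.mem_ofPred_eq]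
  refine forall_congr' fun j => ?_
  by_cases hj : j = i
  · subst hj
    simp only [Pi.add_apply, Pi.single_eq_same, PiLp.add_apply, PiLp.smul_apply,
      PiLp.single_apply, if_true, smul_eq_mul]
    push_cast
    constructor <;> rintro ⟨h1, h2⟩ <;> constructor <;> linarith
  · simp [hj]

lemma tendsto_latticeCube_smallSets (x : EuclideanSpace ℝ (Fin d)) :
    Tendsto (fun ε => latticeCube ε (latticeCell ε x)) (𝓝[>] 0) (𝓝 x).smallSets := by
  rw [tendsto_smallSets_iff]
  intro t ht
  obtain ⟨r, hr, hrt⟩ := Metric.mem_nhds_iff.1 ht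
  have hlim : Tendsto (fun ε : ℝ => d * ε) (𝓝[>] 0) (𝓝 0) := by
    have : Tendsto (fun ε : ℝ => d * ε) (𝓝 0) (𝓝 (d * 0)) := tendsto_id.const_mul _
    rw [mul_zero] at this
    exact this.mono_left nhdsWithin_le_nhds
  filter_upwards [hlim.eventually_lt_const hr, self_mem_nhdsWithin] with ε hεr hε y hy
  exact hrt ((dist_le_of_mem_latticeCube hε ((mem_latticeCube_iff hε).2 rfl) hy).trans_lt hεr)

lemma integrableOn_latticeCube {f : EuclideanSpace ℝ (Fin d) → ℝ} (hf : Continuous f)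
    {ε : ℝ} (hε : 0 < ε) (z : Zd d) : IntegrableOn f (latticeCube ε z) := by
  rcases (latticeCube ε z).eq_empty_or_nonempty with h | ⟨x, hx⟩
  · simp [h]
  · exact hf.continuousOn.integrableOn_of_subset_isCompact (isCompact_closedBall x (d * ε))
      (measurableSet_latticeCube hε z) (fun y hy => dist_le_of_mem_latticeCube hε hx hy)
      (by simp [volume_latticeCube hε])

lemma volume_real_latticeCube {ε : ℝ} (hε : 0 < ε) (z : Zd d) :
    volume.real (latticeCube ε z) = ε ^ d := by
  rw [measureReal_def, volume_latticeCube hε, ENNReal.toReal_ofReal (by positivity)]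

/-- Averages over shrinking cubes around `x` of a family with limit `c` at `x` tend to `c`. -/
lemma tendsto_setIntegral_latticeCube_div {f : ℝ → EuclideanSpace ℝ (Fin d) → ℝ}
    (hf : ∀ ε, Continuous (f ε)) {x : EuclideanSpace ℝ (Fin d)} {c : ℝ}
    (hlim : Tendsto (Function.uncurry f) (𝓝[>] 0 ×ˢ 𝓝 x) (𝓝 c)) :
    Tendsto (fun ε => (∫ y in latticeCube ε (latticeCell ε x), f ε y) / ε ^ d)
      (𝓝[>] 0) (𝓝 c) := by
  rw [Metric.tendsto_nhds]
  intro η hη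
  obtain ⟨P, hP, Q, hQ, hPQ⟩ := eventually_prod_iff.1
    (Metric.tendsto_nhds.1 hlim (η / 2) (half_pos hη))
  filter_upwards [hP, (tendsto_latticeCube_smallSets x).eventually hQ.smallSets,
    self_mem_nhdsWithin] with ε hPε hQε hε
  set s := latticeCube ε (latticeCell ε x)
  have hV : 0 < ε ^ d := pow_pos hε d
  have hbound : ‖∫ y in s, (f ε y - c)‖ ≤ η / 2 * ε ^ d := by
    rw [← volume_real_latticeCube hε (latticeCell ε x)]
    refine norm_setIntegral_le_of_norm_le_const (by simp [s, volume_latticeCube hε]) ?_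
    intro y hy
    exact (hPQ hPε (hQε y hy)).le
  have hsub : ∫ y in s, (f ε y - c) = (∫ y in s, f ε y) - c * ε ^ d := by
    rw [integral_sub (integrableOn_latticeCube (hf ε) hε _)
      (integrableOn_latticeCube continuous_const hε _), setIntegral_const,
      volume_real_latticeCube hε, smul_eq_mul, mul_comm c]
  rw [hsub, Real.norm_eq_abs] at hbound
  rw [Real.dist_eq, div_sub' hV.ne', abs_div, abs_of_pos hV, div_lt_iff₀ hV, mul_comm (ε ^ d)]
  nlinarith

end LatticeCubes

lemma HasStrictFDerivAt.tendsto_slope_prod {E : Type*} [NormedAddCommGroup E] [NormedSpace ℝ E]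
    {g : E → ℝ} {g' : E →L[ℝ] ℝ} {x : E} (hg : HasStrictFDerivAt g g' x) (v : E) :
    Tendsto (fun q : ℝ × E => (g (q.2 + q.1 • v) - g q.2) / q.1) (𝓝[>] 0 ×ˢ 𝓝 x)
      (𝓝 (g' v)) := by
  have hshift : Tendsto (fun q : ℝ × E => q.2 + q.1 • v) (𝓝[>] 0 ×ˢ 𝓝 x) (𝓝 x) := by
    have h : Tendsto (fun q : ℝ × E => q.2 + q.1 • v) (𝓝 (0, x)) (𝓝 (x + (0 : ℝ) • v)) :=
      Continuous.tendsto (by fun_prop) _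
    rw [zero_smul, add_zero, nhds_prod_eq] at h
    exact h.mono_left (prod_mono nhdsWithin_le_nhds le_rfl)
  have ho := hg.isLittleO.comp_tendsto (hshift.prodMk_nhds tendsto_snd)
  have hO : (fun q : ℝ × E => q.1 • v) =O[𝓝[>] 0 ×ˢ 𝓝 x] fun q => q.1 :=
    Asymptotics.IsBigO.of_bound ‖v‖ (Eventually.of_forall fun q => by
      rw [norm_smul, mul_comm])
  have ho' : (fun q : ℝ × E => g (q.2 + q.1 • v) - g q.2 - q.1 * g' v)
      =o[𝓝[>] 0 ×ˢ 𝓝 x] fun q => q.1 := by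
    refine Asymptotics.IsLittleO.trans_isBigO ?_ hO
    simpa [Function.comp_def] using ho
  have hlim := ho'.tendsto_div_nhds_zero.add_const (g' v)
  rw [zero_add] at hlim
  refine hlim.congr' ?_
  have hpos : ∀ᶠ q : ℝ × E in 𝓝[>] 0 ×ˢ 𝓝 x, 0 < q.1 :=
    tendsto_fst.eventually self_mem_nhdsWithin
  filter_upwards [hpos] with q hq
  field_simp
  ring

section CubeSlope

variable {d : ℕ} {g : EuclideanSpace ℝ (Fin d) → ℝ}

/-- Normalised difference quotient of the `L²` norms of `g` over neighbouring cubes. -/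
noncomputable def cubeSlope (g : EuclideanSpace ℝ (Fin d) → ℝ) (i : Fin d) (ε : ℝ)
    (z : Zd d) : ℝ :=
  (Real.sqrt (∫ y in latticeCube ε z, g (y + ε • EuclideanSpace.single i 1) ^ 2) -
    Real.sqrt (∫ y in latticeCube ε z, g y ^ 2)) / (ε * Real.sqrt (ε ^ d))

lemma abs_cubeSlope_le (hg : Continuous g) (hg0 : ∀ x, 0 ≤ g x) {i : Fin d} {ε K : ℝ}
    (hε : 0 < ε) (hK : 0 ≤ K) {z : Zd d}
    (h : ∀ y ∈ latticeCube ε z, |g (y + ε • EuclideanSpace.single i 1) - g y| ≤ K * ε) :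
    |cubeSlope g i ε z| ≤ K := by
  have hV : 0 < ε * Real.sqrt (ε ^ d) := by positivity
  have : IsFiniteMeasure (volume.restrict (latticeCube ε z)) :=
    isFiniteMeasure_restrict.2 (by simp [volume_latticeCube hε])
  have hshift : Continuous fun y => g (y + ε • EuclideanSpace.single i 1) := by fun_prop
  have hmain := abs_sqrt_integral_sq_sub_le (μ := volume.restrict (latticeCube ε z))
    (mul_nonneg hK hε.le) (integrableOn_latticeCube hg hε z)
    (integrableOn_latticeCube hshift hε z) (integrableOn_latticeCube (hg.pow 2) hε z)
    (integrableOn_latticeCube (hshift.pow 2) hε z) (ae_of_all _ hg0)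
    (ae_of_all _ fun y => hg0 _)
    ((ae_restrict_iff' (measurableSet_latticeCube hε z)).2 (ae_of_all _ h))
  rw [measureReal_restrict_apply_univ, volume_real_latticeCube hε] at hmain
  rw [cubeSlope, abs_div, abs_of_pos hV, div_le_iff₀ hV, ← mul_assoc]
  exact hmain

lemma tendsto_cubeSlope (hg : ContDiff ℝ (⊤ : ℕ∞) g) (hg0 : ∀ x, 0 ≤ g x) (i : Fin d)
    (x : EuclideanSpace ℝ (Fin d)) :
    Tendsto (fun ε => cubeSlope g i ε (latticeCell ε x)) (𝓝[>] 0)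
      (𝓝 (fderiv ℝ g x (EuclideanSpace.single i 1))) := by
  set v : EuclideanSpace ℝ (Fin d) := EuclideanSpace.single i 1 with hv
  have hcont : Continuous g := hg.continuous
  have hslope := (hg.contDiffAt.hasStrictFDerivAt (x := x) (by simp)).tendsto_slope_prod v
  rcases (hg0 x).eq_or_lt with h0 | hpos
  · have hzero : fderiv ℝ g x = 0 :=
      IsLocalMin.fderiv_eq_zero (Eventually.of_forall fun y => h0 ▸ hg0 y)
    rw [hzero] at hslope ⊢
    rw [zero_apply] at hslope ⊢
    rw [Metric.tendsto_nhds]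
    intro η hη
    obtain ⟨P, hP, Q, hQ, hPQ⟩ := eventually_prod_iff.1
      (Metric.tendsto_nhds.1 hslope (η / 2) (half_pos hη))
    filter_upwards [hP, (tendsto_latticeCube_smallSets x).eventually hQ.smallSets,
      self_mem_nhdsWithin] with ε hPε hQε hε
    rw [dist_zero_right, Real.norm_eq_abs]
    refine (abs_cubeSlope_le hcont hg0 hε (half_pos hη).le fun y hy => ?_).trans_lt
      (half_lt_self hη)
    have := hPQ hPε (hQε y hy)
    rw [dist_zero_right, Real.norm_eq_abs, abs_div, abs_of_pos (Set.mem_Ioi.1 hε),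
      div_lt_iff₀ hε] at this
    exact this.le
  · have hbase : Tendsto (fun q : ℝ × EuclideanSpace ℝ (Fin d) => g q.2)
        (𝓝[>] 0 ×ˢ 𝓝 x) (𝓝 (g x)) := hcont.continuousAt.tendsto.comp tendsto_snd
    have hshift : Tendsto (fun q : ℝ × EuclideanSpace ℝ (Fin d) => g (q.2 + q.1 • v))
        (𝓝[>] 0 ×ˢ 𝓝 x) (𝓝 (g x)) := by
      have h : Tendsto (fun q : ℝ × EuclideanSpace ℝ (Fin d) => g (q.2 + q.1 • v))
          (𝓝 (0, x)) (𝓝 (g (x + (0 : ℝ) • v))) := Continuous.tendsto (by fun_prop) _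
      rw [zero_smul, add_zero, nhds_prod_eq] at h
      exact h.mono_left (prod_mono nhdsWithin_le_nhds le_rfl)
    have hA := tendsto_setIntegral_latticeCube_div (f := fun _ y => g y ^ 2)
      (fun ε => by fun_prop) (hbase.pow 2)
    have hB := tendsto_setIntegral_latticeCube_div (f := fun ε y => g (y + ε • v) ^ 2)
      (fun ε => by fun_prop) (hshift.pow 2)
    have hD := tendsto_setIntegral_latticeCube_div
      (f := fun ε y => (g (y + ε • v) - g y) / ε * (g (y + ε • v) + g y))
      (fun ε => by fun_prop) (hslope.mul (hshift.add hbase))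
    have hquot := hD.div (hB.sqrt.add hA.sqrt) (by
      rw [Real.sqrt_sq hpos.le]; positivity)
    have hval : fderiv ℝ g x v * (g x + g x) / (√(g x ^ 2) + √(g x ^ 2)) =
        fderiv ℝ g x v := by
      rw [Real.sqrt_sq hpos.le, mul_div_assoc, div_self (by positivity), mul_one]
    rw [hval] at hquot
    refine hquot.congr' ?_
    filter_upwards [hA.eventually_const_lt (show (0 : ℝ) < g x ^ 2 by positivity),
      self_mem_nhdsWithin] with ε hAε hε
    have hε' : 0 < ε := hε
    set s := latticeCube ε (latticeCell ε x)
    have hV : 0 < ε ^ d := pow_pos hε' d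
    have hApos : 0 < ∫ y in s, g y ^ 2 := by
      simpa using (div_pos_iff_of_pos_right hV).1 hAε
    have hdiff : ∫ y in s, (g (y + ε • v) - g y) / ε * (g (y + ε • v) + g y) =
        ((∫ y in s, g (y + ε • v) ^ 2) - ∫ y in s, g y ^ 2) / ε := by
      rw [← integral_sub (integrableOn_latticeCube (by fun_prop) hε' _)
        (integrableOn_latticeCube (by fun_prop) hε' _), ← integral_div]
      congr 1
      ext y
      ring
    have hBnn : 0 ≤ ∫ y in s, g (y + ε • v) ^ 2 := integral_nonneg fun y => sq_nonneg _
    simp only [Pi.div_apply, cubeSlope]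
    rw [hdiff, Real.sqrt_div' _ hV.le, Real.sqrt_div' _ hV.le]
    have hsA := Real.sqrt_pos.2 hApos
    have hsB := Real.sqrt_nonneg (∫ y in s, g (y + ε • v) ^ 2)
    have hw := Real.sqrt_pos.2 hV
    nth_rewrite 1 [← Real.sq_sqrt hBnn, ← Real.sq_sqrt hApos.le, ← Real.sq_sqrt hV.le]
    generalize √(∫ y in s, g y ^ 2) = a at *
    generalize √(∫ y in s, g (y + ε • v) ^ 2) = b at *
    generalize √(ε ^ d) = w at *
    have hab : b + a ≠ 0 := by positivity
    field_simp
    ring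

end CubeSlope

lemma dirS_eq_lintegral_cubeSlope {d : ℕ} {g : EuclideanSpace ℝ (Fin d) → ℝ} {ε : ℝ}
    (hε : 0 < ε) {p : Zd d → ℝ} (hp : ∀ z, p z = ∫ x in latticeCube ε z, g x ^ 2) :
    dirS p = ENNReal.ofReal (ε ^ 2) *
      ∑ i, ∫⁻ x, ENNReal.ofReal (cubeSlope g i ε (latticeCell ε x) ^ 2) := by
  rw [dirS_eq_sum_tsum, Finset.mul_sum]
  refine Finset.sum_congr rfl fun i _ => ?_
  rw [lintegral_comp_latticeCell hε fun z => ENNReal.ofReal (cubeSlope g i ε z ^ 2),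
    ← ENNReal.tsum_mul_left]
  refine tsum_congr fun z => ?_
  have hV : 0 < ε ^ d := pow_pos hε d
  rw [← ENNReal.ofReal_mul hV.le, ← ENNReal.ofReal_mul (sq_nonneg ε), hp, hp,
    setIntegral_latticeCube_add_single, cubeSlope, div_pow, mul_pow, Real.sq_sqrt hV.le]
  congr 1
  field_simp

lemma sum_sq_fderiv_single {d : ℕ} (L : EuclideanSpace ℝ (Fin d) →L[ℝ] ℝ) :
    ∑ i, L (EuclideanSpace.single i 1) ^ 2 = ‖L‖ ^ 2 := by
  set w := (InnerProductSpace.toDual ℝ (EuclideanSpace ℝ (Fin d))).symm L with hw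
  have hL (y : EuclideanSpace ℝ (Fin d)) : L y = inner ℝ w y := by
    rw [hw, InnerProductSpace.toDual_symm_apply]
  rw [← LinearIsometryEquiv.norm_map (InnerProductSpace.toDual ℝ _).symm L, ← hw,
    EuclideanSpace.real_norm_sq_eq]
  refine Finset.sum_congr rfl fun i _ => ?_
  rw [hL, EuclideanSpace.inner_single_right]
  simp

lemma cubeSlope_eq_zero {d : ℕ} {g : EuclideanSpace ℝ (Fin d) → ℝ} {R ε : ℝ}
    (hR : ∀ x, R < ‖x‖ → g x = 0) (hε : 0 < ε) (hε1 : ε ≤ 1) (i : Fin d)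
    {x : EuclideanSpace ℝ (Fin d)} (hx : R + d + 1 < ‖x‖) :
    cubeSlope g i ε (latticeCell ε x) = 0 := by
  have hnear (y) (hy : y ∈ latticeCube ε (latticeCell ε x)) : ‖x‖ - d ≤ ‖y‖ := by
    have hd := dist_le_of_mem_latticeCube hε ((mem_latticeCube_iff hε).2 rfl) hy
    have htri := norm_sub_norm_le x y
    rw [← dist_eq_norm, dist_comm] at htri
    nlinarith [(Nat.cast_nonneg d : (0 : ℝ) ≤ d)]
  have h1 : ∫ y in latticeCube ε (latticeCell ε x), g y ^ 2 = 0 :=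
    setIntegral_eq_zero_of_forall_eq_zero fun y hy => by
      rw [hR y (by linarith [hnear y hy]), zero_pow two_ne_zero]
  have h2 : ∫ y in latticeCube ε (latticeCell ε x),
      g (y + ε • EuclideanSpace.single i 1) ^ 2 = 0 :=
    setIntegral_eq_zero_of_forall_eq_zero fun y hy => by
      have hn : ‖ε • (EuclideanSpace.single i 1 : EuclideanSpace ℝ (Fin d))‖ = ε := by
        simp [norm_smul, abs_of_pos hε]
      have htri := norm_sub_le (y + ε • EuclideanSpace.single i (1 : ℝ))
        (ε • EuclideanSpace.single i 1)
      rw [add_sub_cancel_right, hn] at htri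
      rw [hR _ (by linarith [hnear y hy]), zero_pow two_ne_zero]
  simp [cubeSlope, h1, h2]

lemma tendsto_lintegral_cubeSlope_sq {d : ℕ} {g : EuclideanSpace ℝ (Fin d) → ℝ}
    (hg : ContDiff ℝ (⊤ : ℕ∞) g) (hgc : HasCompactSupport g) (hg0 : ∀ x, 0 ≤ g x) (i : Fin d) :
    Tendsto (fun ε => ∫⁻ x, ENNReal.ofReal (cubeSlope g i ε (latticeCell ε x) ^ 2)) (𝓝[>] 0)
      (𝓝 (∫⁻ x, ENNReal.ofReal (fderiv ℝ g x (EuclideanSpace.single i 1) ^ 2))) := by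
  obtain ⟨C, hC⟩ := hg.lipschitzWith_of_hasCompactSupport hgc (by simp)
  obtain ⟨R, hR⟩ := hgc.isBounded.subset_closedBall 0
  have hR' (x) (hx : R < ‖x‖) : g x = 0 := by
    by_contra hne
    have := hR (subset_tsupport g hne)
    rw [mem_closedBall_zero_iff] at this
    linarith
  have hsmall : ∀ᶠ ε : ℝ in 𝓝[>] 0, ε ≤ 1 :=
    nhdsWithin_le_nhds (eventually_le_nhds zero_lt_one)
  refine tendsto_lintegral_filter_of_dominated_convergence
    ((Metric.closedBall 0 (R + d + 1)).indicator fun _ => ENNReal.ofReal ((C : ℝ) ^ 2))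
    ?_ ?_ ?_ ?_
  · exact Eventually.of_forall fun ε =>
      (measurable_of_countable fun z => ENNReal.ofReal (cubeSlope g i ε z ^ 2)).comp
        (measurable_latticeCell ε)
  · filter_upwards [hsmall, self_mem_nhdsWithin] with ε hε1 hε
    refine ae_of_all _ fun x => ?_
    by_cases hx : x ∈ Metric.closedBall 0 (R + d + 1)
    · rw [Set.indicator_of_mem hx]
      refine ENNReal.ofReal_le_ofReal (sq_le_sq.2 ?_)
      rw [abs_of_nonneg C.coe_nonneg]
      refine abs_cubeSlope_le hg.continuous hg0 hε C.coe_nonneg fun y _ => ?_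
      have h := hC.dist_le_mul (y + ε • EuclideanSpace.single i 1) y
      rwa [Real.dist_eq, dist_self_add_left, norm_smul, Real.norm_eq_abs,
        abs_of_pos (Set.mem_Ioi.1 hε), PiLp.norm_single, norm_one, mul_one] at h
    · rw [Set.indicator_of_notMem hx]
      rw [mem_closedBall_zero_iff, not_le] at hx
      rw [cubeSlope_eq_zero hR' hε hε1 i hx]
      simp
  · rw [lintegral_indicator measurableSet_closedBall, setLIntegral_const]
    exact ENNReal.mul_ne_top ENNReal.ofReal_ne_top measure_closedBall_lt_top.ne
  · exact ae_of_all _ fun x => ENNReal.tendsto_ofReal ((tendsto_cubeSlope hg hg0 i x).pow 2)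

/-- For the discretisation `p_ε` of a smooth compactly supported
`L²`-normalised `g ≥ 0`, one has `ε^{−2}·S(p_ε) → ∫ |∇g|²` as `ε ↓ 0`. -/
theorem stmt14 (d : ℕ) (hd : 1 ≤ d) (g : EuclideanSpace ℝ (Fin d) → ℝ)
    (hg : ContDiff ℝ (⊤ : ℕ∞) g) (hgc : HasCompactSupport g) (hg0 : ∀ x, 0 ≤ g x)
    (hgnorm : ∫ x, (g x) ^ 2 = 1)
    (p : ℝ → Zd d → ℝ)
    (hp : ∀ ε, 0 < ε → ∀ z : Zd d, p ε z =
      ∫ x in {x : EuclideanSpace ℝ (Fin d) |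
        ∀ i, ε * (z i : ℝ) ≤ x i ∧ x i < ε * (z i : ℝ) + ε}, (g x) ^ 2) :
    Tendsto (fun ε => (dirS (p ε)).toReal / ε ^ 2) (𝓝[>] 0)
      (𝓝 (∫ x, ‖fderiv ℝ g x‖ ^ 2)) := by
  have hgrad : Continuous (fderiv ℝ g) := hg.continuous_fderiv (by simp)
  have hsupp : HasCompactSupport fun x => ‖fderiv ℝ g x‖ ^ 2 :=
    HasCompactSupport.of_support_subset_isCompact (hgc.fderiv ℝ).isCompact fun x hx =>
      subset_tsupport _ fun h0 => hx (by simp [h0])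
  have hint : Integrable fun x => ‖fderiv ℝ g x‖ ^ 2 :=
    (hgrad.norm.pow 2).integrable_of_hasCompactSupport hsupp
  have hlimit : ∑ i, ∫⁻ x, ENNReal.ofReal (fderiv ℝ g x (EuclideanSpace.single i 1) ^ 2) =
      ENNReal.ofReal (∫ x, ‖fderiv ℝ g x‖ ^ 2) := by
    rw [ofReal_integral_eq_lintegral_ofReal hint (ae_of_all _ fun x => by positivity),
      ← lintegral_finsetSum]
    · refine lintegral_congr fun x => ?_
      rw [← ENNReal.ofReal_sum_of_nonneg fun i _ => sq_nonneg _, sum_sq_fderiv_single]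
    · intro i _
      have : Continuous fun x => fderiv ℝ g x (EuclideanSpace.single i 1) ^ 2 := by fun_prop
      exact this.measurable.ennreal_ofReal
  have hsum := tendsto_finsetSum Finset.univ fun i _ =>
    tendsto_lintegral_cubeSlope_sq hg hgc hg0 i
  rw [hlimit] at hsum
  have hreal := (ENNReal.tendsto_toReal ENNReal.ofReal_ne_top).comp hsum
  rw [ENNReal.toReal_ofReal (integral_nonneg fun x => by positivity)] at hreal
  refine hreal.congr' ?_
  filter_upwards [self_mem_nhdsWithin] with ε hε
  have hε2 : 0 < ε ^ 2 := pow_pos hε 2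
  rw [dirS_eq_lintegral_cubeSlope hε (hp ε hε), ENNReal.toReal_mul,
    ENNReal.toReal_ofReal hε2.le, mul_div_cancel_left₀ _ hε2.ne', Function.comp_apply]
end

section
/- (Periodisation decreases the Dirichlet form.) Let d ≥ 1, N ≥ 1, and let B_N = ([−N, N] ∩ ℤ)^d. For a probability measure p on ℤ^d define the periodised probability measure p^{per} on B_N by p^{per}(z) := Σ_{k ∈ (2N+1)ℤ^d} p(z + k). Then S^{π}(p^{per}) ≤ S(p), where S^{π}(q) := (1/2) Σ_{z ∈ B_N} Σ_{i=1}^{d} Σ_{σ ∈ {+1,−1}} (√q(τ(z + σe_i)) − √q(z))², with e_i the i-th standard unit vector and τ : ℤ^d → B_N the coordinatewise reduction modulo 2N+1 into B_N (periodic boundary conditions). -/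
open MeasureTheory Filter
open scoped ENNReal NNReal Topology

/-- Coordinatewise reduction modulo `2N+1` into the box `B_N = ([−N,N] ∩ ℤ)^d`. -/
def redN (d N : ℕ) (z : Zd d) : Zd d :=
  fun i => (z i + N) % (2 * (N : ℤ) + 1) - N

/-- The Dirichlet form with periodic boundary conditions on `B_N`. -/
noncomputable def perS (d N : ℕ) (q : Zd d → ℝ) : ℝ≥0∞ :=
  2⁻¹ * ∑ z ∈ Finset.Icc (fun _ => -(N : ℤ)) (fun _ => (N : ℤ)),
    ∑ i : Fin d, ∑ σ ∈ ({1, -1} : Finset ℤ),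
      ENNReal.ofReal
        ((Real.sqrt (q (redN d N (fun j => z j + if j = i then σ else 0))) -
          Real.sqrt (q z)) ^ 2)

/-- The reverse triangle inequality in `ℓ²`, for square roots of summable families. -/
theorem ofReal_sqrt_tsum_sub_sq_le {ι : Type*} {a b : ι → ℝ} (ha : ∀ k, 0 ≤ a k)
    (hb : ∀ k, 0 ≤ b k) (hsa : Summable a) (hsb : Summable b) :
    ENNReal.ofReal ((√(∑' k, a k) - √(∑' k, b k)) ^ 2) ≤
      ∑' k, ENNReal.ofReal ((√(a k) - √(b k)) ^ 2) := by
  have hsq : ∀ {c : ι → ℝ}, (∀ k, 0 ≤ c k) → (fun k => √(c k) ^ (2 : ℝ)) = c := by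
    intro c hc
    funext k
    rw [Real.rpow_two, Real.sq_sqrt (hc k)]
  obtain ⟨hs, hle⟩ := Real.summable_and_inner_le_Lp_mul_Lq_tsum_of_nonneg
    Real.HolderConjugate.two_two
    (fun k => Real.sqrt_nonneg (a k)) (fun k => Real.sqrt_nonneg (b k))
    (by rwa [hsq ha]) (by rwa [hsq hb])
  rw [hsq ha, hsq hb, ← Real.sqrt_eq_rpow, ← Real.sqrt_eq_rpow] at hle
  have hexp : (fun k => (√(a k) - √(b k)) ^ 2) =
      fun k => a k + b k - 2 * (√(a k) * √(b k)) := by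
    funext k
    nlinarith [Real.sq_sqrt (ha k), Real.sq_sqrt (hb k)]
  have hsum : HasSum (fun k => (√(a k) - √(b k)) ^ 2)
      ((∑' k, a k) + (∑' k, b k) - 2 * ∑' k, √(a k) * √(b k)) := by
    rw [hexp]
    exact (hsa.hasSum.add hsb.hasSum).sub (hs.hasSum.mul_left 2)
  rw [← ENNReal.ofReal_tsum_of_nonneg (fun k => sq_nonneg _) hsum.summable, hsum.tsum_eq]
  refine ENNReal.ofReal_le_ofReal ?_
  have hA : √(∑' k, a k) ^ 2 = ∑' k, a k := Real.sq_sqrt (tsum_nonneg ha)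
  have hB : √(∑' k, b k) ^ 2 = ∑' k, b k := Real.sq_sqrt (tsum_nonneg hb)
  rw [sub_sq, hA, hB]
  linarith

/-- The translates of the box `B_N` by `(2N+1)ℤ^d` are disjoint. -/
theorem injective_box_add_period (d N : ℕ) :
    Function.Injective fun x : (Finset.Icc (fun _ => -(N : ℤ)) (fun _ => (N : ℤ)) :
      Finset (Zd d)) × Zd d => (fun i => x.1.1 i + (2 * (N : ℤ) + 1) * x.2 i : Zd d) := by
  rintro ⟨⟨z, hz⟩, k⟩ ⟨⟨w, hw⟩, l⟩ h
  rw [Finset.mem_Icc] at hz hw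
  have hkl : k = l := by
    funext i
    have hi := congrFun h i
    have h1 := hz.1 i
    have h2 := hz.2 i
    have h3 := hw.1 i
    have h4 := hw.2 i
    dsimp only at hi h1 h2 h3 h4
    rcases lt_trichotomy (k i) (l i) with hlt | heq | hlt
    · nlinarith
    · exact heq
    · nlinarith
  subst hkl
  have hzw : z = w := by
    funext i
    simpa using congrFun h i
  subst hzw
  rfl

theorem sum_box_tsum_period_le (d N : ℕ) (F : Zd d → ℝ≥0∞) :
    ∑ z ∈ Finset.Icc (fun _ => -(N : ℤ)) (fun _ => (N : ℤ)),
      ∑' k : Zd d, F (fun i => z i + (2 * (N : ℤ) + 1) * k i) ≤ ∑' z, F z := by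
  rw [← Finset.tsum_subtype, ← ENNReal.tsum_prod]
  exact ENNReal.tsum_comp_le_tsum_of_injective (injective_box_add_period d N) F

theorem injOn_add_single {d : ℕ} (z : Zd d) :
    Set.InjOn (fun (y : Fin d × ℤ) (j : Fin d) => z j + if j = y.1 then y.2 else 0)
      {y | |y.2| = 1} := by
  rintro ⟨i, σ⟩ hx ⟨j, τ⟩ - h
  have hi : (if i = i then σ else 0) = if i = j then τ else 0 :=
    add_left_cancel (congrFun h i)
  by_cases hij : i = j
  · subst hij
    simpa using hi
  · have h0 : σ = 0 := by simpa [hij] using hi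
    simp [h0] at hx

/-- The points `z ± e_i` are distinct nearest neighbours of `z`. -/
theorem sum_neighbours_le {d : ℕ} (z : Zd d) (G : Zd d → ℝ≥0∞) :
    ∑ i : Fin d, ∑ σ ∈ ({1, -1} : Finset ℤ), G (fun j => z j + if j = i then σ else 0) ≤
      ∑' x : Zd d, if (∑ i, |x i - z i|) = 1 then G x else 0 := by
  have hσ : ∀ y ∈ Finset.univ (α := Fin d) ×ˢ ({1, -1} : Finset ℤ), |y.2| = 1 := by
    intro y hy
    obtain h | h : y.2 = 1 ∨ y.2 = -1 := by simpa using hy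
    all_goals simp [h]
  rw [← Finset.sum_product (f := fun y : Fin d × ℤ =>
    G (fun j => z j + if j = y.1 then y.2 else 0))]
  refine le_trans (Finset.sum_le_sum (g := fun y : Fin d × ℤ => (fun x : Zd d =>
    if (∑ i, |x i - z i|) = 1 then G x else 0) (fun j => z j + if j = y.1 then y.2 else 0))
    fun y hy => ?_) ?_
  · have habs : ∀ i, |if i = y.1 then y.2 else 0| = if i = y.1 then |y.2| else 0 := by
      intro i
      split_ifs <;> simp
    simp [habs, hσ y hy]
  · rw [← Finset.sum_image (f := fun x : Zd d =>
      if (∑ i, |x i - z i|) = 1 then G x else 0) ((injOn_add_single z).mono hσ)]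
    exact ENNReal.sum_le_tsum _

/-- The periodisation of a function is invariant under reduction into the box. -/
theorem tsum_period_redN (d N : ℕ) (p : Zd d → ℝ) (z : Zd d) :
    ∑' k : Zd d, p (fun i => redN d N z i + (2 * (N : ℤ) + 1) * k i) =
      ∑' k : Zd d, p (fun i => z i + (2 * (N : ℤ) + 1) * k i) := by
  rw [← (Equiv.addLeft fun i => (z i + N) / (2 * (N : ℤ) + 1)).tsum_eq]
  refine tsum_congr fun k => congrArg p (funext fun i => ?_)
  have h := Int.emod_add_mul_ediv (z i + N) (2 * (N : ℤ) + 1)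
  simp only [redN, Equiv.coe_addLeft, Pi.add_apply]
  linear_combination h

theorem summable_period {d N : ℕ} {p : Zd d → ℝ} (hp : Summable p) (z : Zd d) :
    Summable fun k : Zd d => p (fun i => z i + (2 * (N : ℤ) + 1) * k i) := by
  refine hp.comp_injective (i := fun (k : Zd d) i => z i + (2 * (N : ℤ) + 1) * k i) ?_
  intro k l h
  funext i
  exact mul_left_cancel₀ (by positivity) (add_left_cancel (congrFun h i))

/-- Periodisation decreases the Dirichlet form. -/
theorem stmt16 (d N : ℕ) (hd : 1 ≤ d) (hN : 1 ≤ N) (p : Zd d → ℝ) (hp : IsProb p) :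
    perS d N (fun z => ∑' k : Zd d, p (fun i => z i + (2 * (N : ℤ) + 1) * k i)) ≤ dirS p := by
  unfold perS dirS
  gcongr
  let D : Zd d → Zd d → ℝ≥0∞ := fun z x => ENNReal.ofReal ((√(p x) - √(p z)) ^ 2)
  refine le_trans (Finset.sum_le_sum fun z _ => ?_) (sum_box_tsum_period_le d N
    fun z => ∑' x : Zd d, if (∑ i, |x i - z i|) = 1 then D z x else 0)
  refine le_trans ?_ (ENNReal.tsum_le_tsum fun k => sum_neighbours_le _ (D _))
  rw [Summable.tsum_finsetSum fun _ _ => ENNReal.summable]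
  refine Finset.sum_le_sum fun i _ => ?_
  rw [Summable.tsum_finsetSum fun _ _ => ENNReal.summable]
  refine Finset.sum_le_sum fun σ _ => ?_
  beta_reduce
  rw [tsum_period_redN]
  refine (ofReal_sqrt_tsum_sub_sq_le (fun _ => hp.1 _) (fun _ => hp.1 _)
    (summable_period hp.2.summable _) (summable_period hp.2.summable z)).trans_eq ?_
  simp only [D, add_right_comm]
end

section
/- (Shift lemma.) Let d ≥ 1 and R ≥ 1, and let f : ℝ^d → [0,∞) be measurable and periodic with period 2R in each coordinate. Then there exists y ∈ ℝ^d such that ∫_{Q_R \setminus Q_{R−√R}} f(x + y) dx ≤ (d/√R) · ∫_{Q_R} f(x) dx, where Q_r := [−r, r]^d. -/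
open MeasureTheory Filter
open scoped ENNReal NNReal Topology

namespace ShiftLemma

open scoped Pointwise

/-- The closed cube `[-r, r]^d`. -/
abbrev cube (d : ℕ) (r : ℝ) : Set (EuclideanSpace ℝ (Fin d)) := {x | ∀ i, |x i| ≤ r}

lemma cube_eq_preimage (d : ℕ) (r : ℝ) :
    cube d r = WithLp.ofLp ⁻¹' (Set.univ.pi fun _ : Fin d => Set.Icc (-r) r) := by
  ext x
  simp only [Set.mem_ofPred_eq, Set.mem_preimage, Set.mem_univ_pi, Set.mem_Icc, abs_le]

lemma measurableSet_cube (d : ℕ) (r : ℝ) : MeasurableSet (cube d r) := by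
  rw [cube_eq_preimage]
  exact (PiLp.volume_preserving_ofLp (Fin d)).measurable
    (MeasurableSet.univ_pi fun _ => measurableSet_Icc)

lemma volume_cube (d : ℕ) {r : ℝ} (hr : 0 ≤ r) :
    volume (cube d r) = ENNReal.ofReal ((2 * r) ^ d) := by
  rw [cube_eq_preimage, (PiLp.volume_preserving_ofLp (Fin d)).measure_preimage
    (MeasurableSet.univ_pi fun _ => measurableSet_Icc).nullMeasurableSet, volume_pi_pi]
  simp [Real.volume_Icc, ← two_mul, ENNReal.ofReal_pow (by positivity : 0 ≤ 2 * r)]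

lemma cube_subset_cube (d : ℕ) {r s : ℝ} (h : r ≤ s) : cube d r ⊆ cube d s :=
  fun _ hx i => (hx i).trans h

lemma volume_cube_diff_cube_le (d : ℕ) {R : ℝ} (hR : 1 ≤ R) :
    volume (cube d R \ cube d (R - √R)) ≤
      ENNReal.ofReal (d / √R) * volume (cube d R) := by
  have hs : 1 ≤ √R := Real.one_le_sqrt.2 hR
  have hss : √R * √R = R := Real.mul_self_sqrt (by linarith)
  have hr : 0 ≤ R - √R := by nlinarith
  rw [measure_sdiff (cube_subset_cube d (by linarith)) (measurableSet_cube d _).nullMeasurableSet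
    (by simp [volume_cube d hr]), volume_cube d hr, volume_cube d (by linarith),
    ← ENNReal.ofReal_sub _ (by positivity), ← ENNReal.ofReal_mul (by positivity)]
  apply ENNReal.ofReal_le_ofReal
  have hinv : (√R)⁻¹ ≤ 1 := inv_le_one_of_one_le₀ hs
  have hbern := one_add_mul_le_pow (a := -(√R)⁻¹) (by linarith) d
  have hfac : 2 * (R - √R) = 2 * R * (1 + -(√R)⁻¹) := by
    field_simp
    nlinarith
  rw [hfac, mul_pow (2 * R), div_eq_mul_inv]
  have hpos : 0 ≤ (2 * R) ^ d := by positivity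
  linarith [mul_le_mul_of_nonneg_left hbern hpos]

lemma setLIntegral_fundamentalDomain_add_left {ι E : Type*} [Finite ι] [NormedAddCommGroup E]
    [NormedSpace ℝ E] [MeasurableSpace E] [BorelSpace E]
    (b : Module.Basis ι ℝ E) (μ : Measure E) [μ.IsAddLeftInvariant]
    (F : E → ℝ≥0∞) (hF : ∀ x i, F (x + b i) = F x) (x : E) :
    ∫⁻ y in ZSpan.fundamentalDomain b, F (x + y) ∂μ =
      ∫⁻ y in ZSpan.fundamentalDomain b, F y ∂μ := by
  have hper : ∀ v ∈ Submodule.span ℤ (Set.range b), ∀ x, F (v + x) = F x := by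
    intro v hv
    induction hv using Submodule.span_induction with
    | mem v hv =>
      obtain ⟨i, rfl⟩ := hv
      intro x
      rw [add_comm, hF]
    | zero => simp
    | add v w _ _ hv hw => intro x; rw [add_assoc, hv, hw]
    | smul n v _ hv =>
      intro x
      have := (show Function.Periodic F v from fun x => by rw [add_comm, hv]).zsmul n x
      rwa [add_comm]
  have : FiniteDimensional ℝ E := b.finiteDimensional_of_finite
  have : Countable (Submodule.span ℤ (Set.range b)).toAddSubgroup :=
    inferInstanceAs (Countable (Submodule.span ℤ (Set.range b)))
  have hfd := ZSpan.isAddFundamentalDomain' b μ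
  have hshift := hfd.vadd_of_comm x
  have h := (measurePreserving_add_left μ x).setLIntegral_comp_emb
    (measurableEmbedding_addLeft x) F (ZSpan.fundamentalDomain b)
  rw [h]
  exact hshift.setLIntegral_eq hfd F fun g y => hper g g.2 y

lemma setLIntegral_cube_add_left {d : ℕ} {R : ℝ} (hR : 0 < R)
    (F : EuclideanSpace ℝ (Fin d) → ℝ≥0∞)
    (hF : ∀ x i, F (x + (2 * R) • EuclideanSpace.single i (1 : ℝ)) = F x)
    (x : EuclideanSpace ℝ (Fin d)) :
    ∫⁻ y in cube d R, F (x + y) = ∫⁻ y in cube d R, F y := by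
  have h2R : (2 * R) ≠ 0 := by positivity
  let b := (EuclideanSpace.basisFun (Fin d) ℝ).toBasis.isUnitSMul
    (w := fun _ => 2 * R) fun _ => h2R.isUnit
  have hb : ∀ i, b i = (2 * R) • EuclideanSpace.single i (1 : ℝ) := fun i => by
    simp [b, Module.Basis.isUnitSMul_apply]
  let c : EuclideanSpace ℝ (Fin d) := WithLp.toLp 2 fun _ => R
  have hcube : cube d R =ᵐ[volume] (fun y => c + y) ⁻¹' ZSpan.fundamentalDomain b := by
    have hD : (fun y => c + y) ⁻¹' ZSpan.fundamentalDomain b =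
        WithLp.ofLp ⁻¹' (Set.univ.pi fun _ : Fin d => Set.Ico (-R) R) := by
      ext y
      simp only [Set.mem_preimage, ZSpan.mem_fundamentalDomain, Set.mem_univ_pi]
      refine forall_congr' fun i => ?_
      have : b.repr (c + y) i = (R + y i) / (2 * R) := by
        simp [b, c, Module.Basis.repr_isUnitSMul, Units.smul_def]
        field_simp
      rw [this, Set.mem_Ico, Set.mem_Ico, div_lt_one (by positivity),
        le_div_iff₀ (by positivity), zero_mul]
      constructor <;> rintro ⟨h₁, h₂⟩ <;> constructor <;> linarith
    rw [hD, cube_eq_preimage]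
    exact (PiLp.volume_preserving_ofLp (Fin d)).quasiMeasurePreserving.preimage_ae_eq
      Measure.pi_Ico_ae_eq_pi_Icc.symm
  have hshift : ∀ z, ∫⁻ y in cube d R, F (z + y) = ∫⁻ y in ZSpan.fundamentalDomain b, F y := by
    intro z
    rw [setLIntegral_congr hcube,
      ← setLIntegral_fundamentalDomain_add_left b volume F (fun x i => by rw [hb, hF]) (z - c),
      ← (measurePreserving_add_left volume c).setLIntegral_comp_preimage_emb
        (measurableEmbedding_addLeft c) (fun y => F (z - c + y))]
    simp [← add_assoc]
  simpa using (hshift x).trans (hshift 0).symm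

end ShiftLemma

/-- **shift lemma.** A nonnegative function that is `2R`-periodic in each
coordinate can be shifted so that its mass on the boundary layer `Q_R \ Q_{R−√R}` is at most
`(d/√R)` times its mass on `Q_R`, where `Q_r = [−r,r]^d`. -/
theorem stmt18 (d : ℕ) (hd : 1 ≤ d) (R : ℝ) (hR : 1 ≤ R)
    (f : EuclideanSpace ℝ (Fin d) → ℝ) (hfm : Measurable f) (hf0 : ∀ x, 0 ≤ f x)
    (hper : ∀ x : EuclideanSpace ℝ (Fin d), ∀ i : Fin d,
      f (x + (2 * R) • EuclideanSpace.single i (1 : ℝ)) = f x) :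
    ∃ y : EuclideanSpace ℝ (Fin d),
      ∫⁻ x in {x : EuclideanSpace ℝ (Fin d) | ∀ i, |x i| ≤ R} \
          {x : EuclideanSpace ℝ (Fin d) | ∀ i, |x i| ≤ R - Real.sqrt R},
        ENNReal.ofReal (f (x + y)) ≤
      ENNReal.ofReal (d / Real.sqrt R) *
        ∫⁻ x in {x : EuclideanSpace ℝ (Fin d) | ∀ i, |x i| ≤ R}, ENNReal.ofReal (f x) := by
  let F : EuclideanSpace ℝ (Fin d) → ℝ≥0∞ := fun x => ENNReal.ofReal (f x)
  have hF : Measurable F := hfm.ennreal_ofReal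
  have hR0 : 0 < R := by linarith
  let Q := ShiftLemma.cube d R
  let A := ShiftLemma.cube d R \ ShiftLemma.cube d (R - √R)
  have hQ : volume Q = ENNReal.ofReal ((2 * R) ^ d) := ShiftLemma.volume_cube d hR0.le
  have hQ0 : volume Q ≠ 0 := by
    rw [hQ]
    exact (ENNReal.ofReal_pos.2 (by positivity)).ne'
  have hQtop : volume Q ≠ ∞ := by simp [hQ]
  have hFadd : Measurable fun p : EuclideanSpace ℝ (Fin d) × EuclideanSpace ℝ (Fin d) =>
      F (p.2 + p.1) := hF.comp (measurable_snd.add measurable_fst)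
  obtain ⟨y, -, hy⟩ := exists_le_setLAverage (μ := volume) (s := Q)
    (f := fun y => ∫⁻ x in A, F (x + y)) hQ0 hQtop hFadd.lintegral_prod_right'.aemeasurable
  refine ⟨y, hy.trans ?_⟩
  rw [setLAverage_eq, lintegral_lintegral_swap hFadd.aemeasurable]
  simp only [Q, ShiftLemma.setLIntegral_cube_add_left hR0 F (fun x i => by simp only [F, hper]),
    setLIntegral_const]
  refine ENNReal.div_le_of_le_mul ?_
  rw [mul_right_comm, mul_comm]
  exact mul_le_mul_left (ShiftLemma.volume_cube_diff_cube_le d hR) _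
end

section
/- Let d ≥ 1, ρ > 0 and γ > 1 with γ(d−2) < d and d(γ−1) < 2. Let (a_n) be a sequence in (0,∞) with a_n → ∞ and let (p_n) be probability measures on ℤ^d such that a_n²·S(p_n) → ∞. Then a_n² · ( S(p_n) + (ρ/(a_n^{2+d(1−γ)}·(1−γ))) · Σ_{z∈ℤ^d} p_n(z)^γ ) → ∞ as n → ∞. -/
open MeasureTheory Filter
open scoped ENNReal NNReal Topology

/-- The squared `ℓ²` distance between `u` and its translate by `x`. -/
noncomputable def translEnergy {d : ℕ} (u : Zd d → ℝ) (x : Zd d) : ℝ≥0∞ :=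
  ∑' z : Zd d, ENNReal.ofReal ((u (z + x) - u z) ^ 2)

theorem tsum_ofReal_sq_sum_le {α ι : Type*} (s : Finset ι) (f : ι → α → ℝ) :
    ∑' z, ENNReal.ofReal ((∑ i ∈ s, f i z) ^ 2)
      ≤ s.card * ∑ i ∈ s, ∑' z, ENNReal.ofReal (f i z ^ 2) := by
  rw [← Summable.tsum_finsetSum (fun _ _ => ENNReal.summable), ← ENNReal.tsum_mul_left]
  refine ENNReal.tsum_le_tsum fun z => ?_
  rw [← ENNReal.ofReal_sum_of_nonneg (fun i _ => sq_nonneg _), ← ENNReal.ofReal_natCast,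
    ← ENNReal.ofReal_mul (Nat.cast_nonneg _)]
  exact ENNReal.ofReal_le_ofReal sq_sum_le_card_mul_sum_sq

theorem translEnergy_sum_range_le {d : ℕ} (u : Zd d → ℝ) (y : ℕ → Zd d) (m : ℕ) :
    translEnergy u (∑ j ∈ Finset.range m, y j)
      ≤ m * ∑ j ∈ Finset.range m, translEnergy u (y j) := by
  have key := tsum_ofReal_sq_sum_le (Finset.range m) fun j (z : Zd d) =>
    u (z + ∑ i ∈ Finset.range (j + 1), y i) - u (z + ∑ i ∈ Finset.range j, y i)
  rw [Finset.card_range] at key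
  convert key using 1
  · refine tsum_congr fun z => ?_
    rw [Finset.sum_range_sub (fun j => u (z + ∑ i ∈ Finset.range j, y i))]
    simp
  · congr 1
    refine Finset.sum_congr rfl fun j _ => ?_
    rw [translEnergy, ← (Equiv.addRight (∑ i ∈ Finset.range j, y i)).tsum_eq]
    refine tsum_congr fun z => ?_
    simp only [Equiv.coe_addRight, Finset.sum_range_succ, add_assoc]

theorem translEnergy_single_le {d : ℕ} (p : Zd d → ℝ) (i : Fin d) :
    translEnergy (fun z => Real.sqrt (p z)) (Pi.single i 1) ≤ 2 * dirS p := by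
  rw [dirS, ← mul_assoc, ENNReal.mul_inv_cancel (by simp) (by simp), one_mul]
  refine ENNReal.tsum_le_tsum fun z => ?_
  refine le_trans (le_of_eq ?_) (ENNReal.le_tsum (z + Pi.single i 1))
  have h : ∑ j, |(z + Pi.single i 1 : Zd d) j - z j| = 1 := by
    rw [Finset.sum_eq_single i] <;> simp +contextual
  rw [if_pos h]

theorem translEnergy_le {d : ℕ} (p : Zd d → ℝ) {L : ℕ} (x : Fin d → ℕ) (hx : ∀ i, x i ≤ L) :
    translEnergy (fun z => Real.sqrt (p z)) (fun i => (x i : ℤ))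
      ≤ 2 * d ^ 2 * L ^ 2 * dirS p := by
  have haxis (i : Fin d) :
      translEnergy (fun z => Real.sqrt (p z)) (x i • Pi.single i 1) ≤ 2 * L ^ 2 * dirS p := by
    have h := translEnergy_sum_range_le (fun z => Real.sqrt (p z))
      (fun _ => Pi.single i 1) (x i)
    simp only [Finset.sum_const, Finset.card_range, nsmul_eq_mul] at h
    rw [nsmul_eq_mul]
    refine h.trans ?_
    have hL : (x i : ℝ≥0∞) ≤ L := by exact_mod_cast hx i
    calc _ ≤ (L : ℝ≥0∞) * (L * (2 * dirS p)) := by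
          gcongr
          exact translEnergy_single_le p i
      _ = _ := by ring
  have h := translEnergy_sum_range_le (fun z => Real.sqrt (p z))
    (fun j => if h : j < d then x ⟨j, h⟩ • Pi.single ⟨j, h⟩ 1 else 0) d
  rw [Finset.sum_range, Finset.sum_range] at h
  simp only [Fin.is_lt, dite_true, Fin.eta] at h
  have hsum : ∑ i : Fin d, x i • (Pi.single i 1 : Zd d) = fun i => (x i : ℤ) := by
    ext j
    simp [Finset.sum_apply, Pi.single_apply]
  rw [hsum] at h
  refine h.trans ?_
  calc (d : ℝ≥0∞) * ∑ i : Fin d, _ ≤ d * ∑ _i : Fin d, 2 * L ^ 2 * dirS p := by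
        gcongr with i
        exact haxis i
    _ = _ := by simp; ring

/-- The mass carried by the sites where `p` exceeds `4 / L ^ d` is controlled by `L² S(p)`. -/
theorem tsum_large_le {d : ℕ} {p : Zd d → ℝ} (hp : IsProb p) {L : ℕ} (hL : 0 < L) :
    ∑' z, (if 4 / (L : ℝ) ^ d < p z then ENNReal.ofReal (p z) else 0)
      ≤ 8 * d ^ 2 * L ^ 2 * dirS p := by
  set box : Finset (Fin d → ℕ) := Fintype.piFinset fun _ => Finset.range L with hbox
  have hcard : box.card = L ^ d := by simp [hbox]
  set u : Zd d → ℝ := fun z => Real.sqrt (p z) with hu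
  have hN : (0 : ℝ) < (L : ℝ) ^ d := by positivity
  let c : (Fin d → ℕ) → Zd d := fun x i => (x i : ℤ)
  have hc : Function.Injective c := fun x y h => by
    ext i
    exact Int.ofNat.inj (congrFun h i)
  have hmass (z : Zd d) : ∑ x ∈ box, p (z + c x) ≤ 1 := by
    have hinj : Function.Injective fun x => z + c x := (add_right_injective z).comp hc
    calc ∑ x ∈ box, p (z + c x) = ∑ y ∈ box.map ⟨_, hinj⟩, p y := by simp
      _ ≤ 1 := sum_le_hasSum _ (fun y _ => hp.1 y) hp.2
  have hpt (z : Zd d) : ((L : ℝ≥0∞) ^ d) *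
      (if 4 / (L : ℝ) ^ d < p z then ENNReal.ofReal (p z) else 0)
        ≤ 4 * ∑ x ∈ box, ENNReal.ofReal ((u (z + c x) - u z) ^ 2) := by
    split_ifs with h
    · rw [div_lt_iff₀ hN] at h
      have h1 : (L : ℝ) ^ d * p z ≤
          2 * ∑ x ∈ box, (u (z + c x) - u z) ^ 2 + 2 * ∑ x ∈ box, p (z + c x) := by
        calc (L : ℝ) ^ d * p z = ∑ x ∈ box, p z := by simp [hcard]
          _ ≤ ∑ x ∈ box, (2 * (u (z + c x) - u z) ^ 2 + 2 * p (z + c x)) := by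
              refine Finset.sum_le_sum fun x _ => ?_
              have e1 := Real.sq_sqrt (hp.1 z)
              have e2 := Real.sq_sqrt (hp.1 (z + c x))
              simp only [hu]
              nlinarith [sq_nonneg (2 * Real.sqrt (p (z + c x)) - Real.sqrt (p z))]
          _ = _ := by rw [Finset.sum_add_distrib, Finset.mul_sum, Finset.mul_sum]
      have h2 : (L : ℝ) ^ d * p z ≤ 4 * ∑ x ∈ box, (u (z + c x) - u z) ^ 2 := by
        nlinarith [hmass z]
      have h3 := ENNReal.ofReal_le_ofReal h2
      rw [ENNReal.ofReal_mul hN.le, ENNReal.ofReal_mul (by norm_num),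
        ENNReal.ofReal_sum_of_nonneg (fun _ _ => sq_nonneg _),
        ENNReal.ofReal_pow (Nat.cast_nonneg _), ENNReal.ofReal_natCast] at h3
      simpa using h3
    · simp
  have hN0 : ((L : ℝ≥0∞) ^ d) ≠ 0 := by simp [hL.ne']
  have hNtop : ((L : ℝ≥0∞) ^ d) ≠ ⊤ := by simp
  rw [← ENNReal.mul_le_mul_iff_right hN0 hNtop, ← ENNReal.tsum_mul_left]
  calc _ ≤ ∑' z, 4 * ∑ x ∈ box, ENNReal.ofReal ((u (z + c x) - u z) ^ 2) :=
        ENNReal.tsum_le_tsum hpt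
    _ = 4 * ∑ x ∈ box, translEnergy u (c x) := by
        rw [ENNReal.tsum_mul_left, Summable.tsum_finsetSum (fun _ _ => ENNReal.summable)]
        rfl
    _ ≤ 4 * ∑ x ∈ box, 2 * d ^ 2 * L ^ 2 * dirS p := by
        gcongr with x hx
        refine translEnergy_le p x fun i => ?_
        exact (Finset.mem_range.1 (Fintype.mem_piFinset.1 hx i)).le
    _ = _ := by
        rw [Finset.sum_const, hcard, nsmul_eq_mul]
        push_cast
        ring

/-- Dyadic decomposition of a nonnegative power along an arbitrary sequence of thresholds. -/
theorem rpow_le_sum_thresholds {x r : ℝ} (hx : 0 ≤ x) (hr : 0 ≤ r) {T : ℕ → ℝ}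
    (hT : ∀ k, 0 ≤ T k) (hx0 : x ≤ T 0) (K : ℕ) :
    x ^ r ≤ T K ^ r + ∑ k ∈ Finset.range K, if T (k + 1) < x then T k ^ r else 0 := by
  have hnn (K : ℕ) : 0 ≤ ∑ k ∈ Finset.range K, if T (k + 1) < x then T k ^ r else 0 :=
    Finset.sum_nonneg fun k _ => by
      split_ifs
      · exact Real.rpow_nonneg (hT k) r
      · exact le_rfl
  induction K with
  | zero => simpa using Real.rpow_le_rpow hx hx0 hr
  | succ K ih =>
    by_cases h : T (K + 1) < x
    · rw [Finset.sum_range_succ, if_pos h]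
      linarith [Real.rpow_nonneg (hT (K + 1)) r]
    · linarith [Real.rpow_le_rpow hx (not_lt.1 h) hr, hnn (K + 1)]

theorem IsProb.le_one {d : ℕ} {p : Zd d → ℝ} (hp : IsProb p) (z : Zd d) : p z ≤ 1 :=
  le_hasSum hp.2 z fun y _ => hp.1 y

theorem tsum_rpow_le {d : ℕ} {p : Zd d → ℝ} (hp : IsProb p) {γ : ℝ} (hγ : 1 < γ) (K : ℕ) :
    ∑' z, ENNReal.ofReal (p z ^ γ) ≤ ENNReal.ofReal ((4 / ((2 : ℝ) ^ K) ^ d) ^ (γ - 1)) +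
      ∑ k ∈ Finset.range K, ENNReal.ofReal ((4 / ((2 : ℝ) ^ k) ^ d) ^ (γ - 1)) *
        (32 * d ^ 2 * 4 ^ k * dirS p) := by
  set T : ℕ → ℝ := fun k => 4 / ((2 : ℝ) ^ k) ^ d with hTdef
  have hT (k : ℕ) : 0 ≤ T k := by positivity
  have hTr (k : ℕ) : 0 ≤ T k ^ (γ - 1) := Real.rpow_nonneg (hT k) _
  have hpt (z : Zd d) : ENNReal.ofReal (p z ^ γ) ≤
      ENNReal.ofReal (T K ^ (γ - 1)) * ENNReal.ofReal (p z) +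
      ∑ k ∈ Finset.range K, ENNReal.ofReal (T k ^ (γ - 1)) *
        (if T (k + 1) < p z then ENNReal.ofReal (p z) else 0) := by
    have h0 : p z ≤ T 0 := (hp.le_one z).trans (by norm_num [hTdef])
    have h := rpow_le_sum_thresholds (hp.1 z) (sub_nonneg.2 hγ.le) hT h0 K
    have h' := mul_le_mul_of_nonneg_right h (hp.1 z)
    have e : p z ^ γ = p z ^ (γ - 1) * p z := by
      rw [← Real.rpow_add_one' (hp.1 z) (by linarith), sub_add_cancel]
    rw [← e, add_mul, Finset.sum_mul] at h'
    refine (ENNReal.ofReal_le_ofReal h').trans ?_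
    refine ENNReal.ofReal_add_le.trans ?_
    rw [ENNReal.ofReal_mul (hTr K), ENNReal.ofReal_sum_of_nonneg]
    · gcongr with k
      split_ifs
      · rw [ENNReal.ofReal_mul (hTr k)]
      · simp
    · intro k _
      split_ifs
      · exact mul_nonneg (hTr k) (hp.1 z)
      · simp
  have hone : ∑' z, ENNReal.ofReal (p z) = 1 := by
    rw [← ENNReal.ofReal_tsum_of_nonneg hp.1 hp.2.summable, hp.2.tsum_eq, ENNReal.ofReal_one]
  refine (ENNReal.tsum_le_tsum hpt).trans ?_
  rw [ENNReal.tsum_add, ENNReal.tsum_mul_left, hone, mul_one,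
    Summable.tsum_finsetSum (fun _ _ => ENNReal.summable)]
  gcongr with k
  rw [ENNReal.tsum_mul_left]
  gcongr
  have h := tsum_large_le hp (L := 2 ^ (k + 1)) (by positivity)
  push_cast at h
  refine h.trans (le_of_eq ?_)
  rw [← pow_mul, mul_comm (k + 1) 2, pow_mul, pow_succ]
  norm_num
  ring

/-- A discrete subcritical Gagliardo–Nirenberg inequality at scale `2 ^ K`. -/
theorem exists_gagliardo_nirenberg (d : ℕ) {γ : ℝ} (hγ : 1 < γ) (hγd : (d : ℝ) * (γ - 1) < 2) :
    ∃ C : ℝ, 0 < C ∧ ∀ p : Zd d → ℝ, IsProb p → dirS p ≠ ⊤ → ∀ K : ℕ,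
      ∑' z, p z ^ γ ≤ C * (((2 : ℝ) ^ K) ^ (d * (γ - 1)))⁻¹ *
        (1 + ((2 : ℝ) ^ K) ^ 2 * (dirS p).toReal) := by
  set β : ℝ := d * (γ - 1) with hβ
  set q : ℝ := ((2 : ℝ) ^ β)⁻¹ with hq
  have hq0 : 0 < q := by positivity
  have hq4 : 0 < 4 * q - 1 := by
    have h : (2 : ℝ) ^ β < 2 ^ (2 : ℝ) := Real.rpow_lt_rpow_of_exponent_lt (by norm_num) hγd
    have h' : (2 : ℝ) ^ β < 4 := by
      refine h.trans_eq ?_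
      norm_num
    have : 1 < 4 * q := by
      rw [hq, ← div_eq_mul_inv, one_lt_div (by positivity)]
      exact h'
    linarith
  have hqK (k : ℕ) : (((2 : ℝ) ^ k) ^ β)⁻¹ = q ^ k := by
    rw [hq, inv_pow, ← Real.rpow_natCast, ← Real.rpow_mul (by norm_num), mul_comm,
      Real.rpow_mul (by norm_num), Real.rpow_natCast]
  have hTq (k : ℕ) : (4 / ((2 : ℝ) ^ k) ^ d) ^ (γ - 1) = 4 ^ (γ - 1) * q ^ k := by
    rw [Real.div_rpow (by norm_num) (by positivity), div_eq_mul_inv, ← hqK, hβ,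
      Real.rpow_mul (by positivity), Real.rpow_natCast]
  set A : ℝ := 4 ^ (γ - 1) with hA
  have hA0 : 0 < A := by positivity
  refine ⟨A * (1 + 32 * d ^ 2 / (4 * q - 1)), by positivity, fun p hp hS K => ?_⟩
  set s : ℝ := (dirS p).toReal with hs
  have hs0 : 0 ≤ s := ENNReal.toReal_nonneg
  have hmain := tsum_rpow_le hp hγ K
  simp only [hTq] at hmain
  have hSs : dirS p = ENNReal.ofReal s := (ENNReal.ofReal_toReal hS).symm
  have hrhs : ENNReal.ofReal (A * q ^ K) + ∑ k ∈ Finset.range K, ENNReal.ofReal (A * q ^ k) *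
        (32 * d ^ 2 * 4 ^ k * dirS p) =
      ENNReal.ofReal (A * q ^ K + ∑ k ∈ Finset.range K, A * q ^ k *
        (32 * d ^ 2 * 4 ^ k * s)) := by
    rw [ENNReal.ofReal_add (by positivity) (Finset.sum_nonneg fun k _ => by positivity),
      ENNReal.ofReal_sum_of_nonneg (fun k _ => by positivity), hSs]
    congr 1
    refine Finset.sum_congr rfl fun k _ => ?_
    rw [ENNReal.ofReal_mul (p := A * q ^ k) (by positivity),
      ENNReal.ofReal_mul (q := s) (by positivity),
      ENNReal.ofReal_mul (q := (4 : ℝ) ^ k) (by positivity),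
      ENNReal.ofReal_mul (q := (d : ℝ) ^ 2) (by positivity),
      ENNReal.ofReal_pow (by positivity), ENNReal.ofReal_pow (by positivity)]
    simp
  rw [hrhs] at hmain
  have hpow0 (z : Zd d) : 0 ≤ p z ^ γ := Real.rpow_nonneg (hp.1 z) γ
  have hsm : Summable fun z => p z ^ γ := by
    refine Summable.of_nonneg_of_le hpow0 (fun z => ?_) hp.2.summable
    exact Real.rpow_le_self_of_le_one (hp.1 z) (hp.le_one z) hγ.le
  rw [← ENNReal.ofReal_tsum_of_nonneg hpow0 hsm] at hmain
  have hreal := (ENNReal.ofReal_le_ofReal_iff (by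
    have := Finset.sum_nonneg (s := Finset.range K)
      (f := fun k => A * q ^ k * (32 * d ^ 2 * 4 ^ k * s)) fun k _ => by positivity
    positivity)).1 hmain
  refine hreal.trans ?_
  have hgeom : ∑ k ∈ Finset.range K, A * q ^ k * (32 * d ^ 2 * 4 ^ k * s) =
      A * (32 * d ^ 2) * s * (((4 * q) ^ K - 1) / (4 * q - 1)) := by
    rw [← geom_sum_eq (by linarith), Finset.mul_sum]
    refine Finset.sum_congr rfl fun k _ => ?_
    rw [mul_pow]
    ring
  rw [hgeom, hqK]
  have h4 : ((2 : ℝ) ^ K) ^ 2 = 4 ^ K := by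
    rw [← pow_mul, mul_comm, pow_mul]
    norm_num
  rw [h4]
  have h5 : ((4 * q) ^ K - 1) / (4 * q - 1) ≤ (4 * q) ^ K / (4 * q - 1) := by
    gcongr
    linarith
  set B : ℝ := 32 * d ^ 2 with hB
  have hB0 : 0 ≤ B := by positivity
  calc _ ≤ A * q ^ K + A * B * s * ((4 * q) ^ K / (4 * q - 1)) := by gcongr
    _ = A * q ^ K * (1 + B / (4 * q - 1) * (4 ^ K * s)) := by
        rw [mul_pow]
        ring
    _ ≤ A * q ^ K * ((1 + B / (4 * q - 1)) * (1 + 4 ^ K * s)) := by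
        gcongr
        have : 0 ≤ B / (4 * q - 1) := by positivity
        have : 0 ≤ 4 ^ K * s := by positivity
        nlinarith
    _ = _ := by ring

/-- The potential term is a relatively small perturbation of the rescaled Dirichlet form. -/
theorem exists_half_dirichlet_bound (d : ℕ) {γ : ℝ} (hγ : 1 < γ)
    (hγd : (d : ℝ) * (γ - 1) < 2) {c : ℝ} (hc : 0 < c) :
    ∃ M a₀ : ℝ, ∀ p : Zd d → ℝ, IsProb p → dirS p ≠ ⊤ → ∀ a : ℝ, 0 < a → a₀ ≤ a →
      c * a ^ (d * (γ - 1)) * ∑' z, p z ^ γ ≤ M + a ^ 2 * (dirS p).toReal / 2 := by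
  obtain ⟨C, hC, hGN⟩ := exists_gagliardo_nirenberg d hγ hγd
  set β : ℝ := d * (γ - 1) with hβ
  have hβ0 : 0 ≤ β := mul_nonneg (Nat.cast_nonneg _) (by linarith)
  obtain ⟨δ, hδ, hδ0⟩ : ∃ δ : ℝ, c * C * 2 ^ β * δ ^ (2 - β) < 1 / 2 ∧ 0 < δ := by
    have h : Tendsto (fun δ : ℝ => c * C * 2 ^ β * δ ^ (2 - β)) (𝓝[>] 0) (𝓝 0) := by
      have h1 := (Real.continuousAt_rpow_const 0 (2 - β) (Or.inr (by linarith))).tendsto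
      rw [Real.zero_rpow (by linarith)] at h1
      simpa using (h1.mono_left nhdsWithin_le_nhds).const_mul (c * C * 2 ^ β)
    exact ((h.eventually (gt_mem_nhds (by norm_num))).and self_mem_nhdsWithin).exists
  refine ⟨c * C * (2 / δ) ^ β, 1 / δ, fun p hp hS a ha haδ => ?_⟩
  set s := (dirS p).toReal
  have hs0 : 0 ≤ s := ENNReal.toReal_nonneg
  have hone : 1 ≤ a * δ := (div_le_iff₀ hδ0).1 haδ
  obtain ⟨K, hK1, hK2⟩ := exists_nat_pow_near hone (one_lt_two (α := ℝ))
  set l : ℝ := 2 ^ K with hl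
  have hl0 : 0 < l := by positivity
  have ha' : a ≤ 2 / δ * l := by
    rw [div_mul_eq_mul_div, le_div_iff₀ hδ0]
    rw [pow_succ] at hK2
    linarith
  have hpowa : a ^ β ≤ (2 / δ) ^ β * l ^ β := by
    rw [← Real.mul_rpow (by positivity) hl0.le]
    exact Real.rpow_le_rpow ha.le ha' hβ0
  have hl2 : l ^ 2 * s ≤ (a * δ) ^ 2 * s := by gcongr
  have hlβ : l ^ β ≠ 0 := by positivity
  calc c * a ^ β * ∑' z, p z ^ γ
      ≤ c * ((2 / δ) ^ β * l ^ β) * (C * (l ^ β)⁻¹ * (1 + (a * δ) ^ 2 * s)) := by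
        have h := hGN p hp hS K
        have h0 : 0 ≤ ∑' z, p z ^ γ := tsum_nonneg fun z => Real.rpow_nonneg (hp.1 z) γ
        gcongr
        exact h.trans (by gcongr)
    _ = c * C * (2 / δ) ^ β + (c * C * ((2 / δ) ^ β * δ ^ 2)) * (a ^ 2 * s) := by
        field_simp
    _ = c * C * (2 / δ) ^ β + (c * C * 2 ^ β * δ ^ (2 - β)) * (a ^ 2 * s) := by
        rw [Real.rpow_sub hδ0, Real.rpow_two, Real.div_rpow (by norm_num) hδ0.le]
        ring
    _ ≤ c * C * (2 / δ) ^ β + 1 / 2 * (a ^ 2 * s) := by gcongr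
    _ = _ := by ring

/-- If `a_n → ∞` and `a_n²·S(p_n) → ∞`, then (for `1 < γ` with
`γ(d−2) < d` and `d(γ−1) < 2`) also
`a_n²·(S(p_n) + (ρ/(a_n^{2+d(1−γ)}(1−γ)))·Σ_z p_n(z)^γ) → ∞`. -/
theorem stmt19 (d : ℕ) (hd : 1 ≤ d) (ρ γ : ℝ) (hρ : 0 < ρ) (hγ : 1 < γ)
    (hγd : γ * ((d : ℝ) - 2) < d) (hγd2 : (d : ℝ) * (γ - 1) < 2)
    (a : ℕ → ℝ) (ha : ∀ n, 0 < a n) (hatop : Tendsto a atTop atTop)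
    (p : ℕ → Zd d → ℝ) (hp : ∀ n, IsProb (p n))
    (hS : Tendsto (fun n => ENNReal.ofReal (a n ^ 2) * dirS (p n)) atTop (𝓝 ⊤)) :
    Tendsto (fun n =>
        ((a n ^ 2 : ℝ) : EReal) * ((dirS (p n) : EReal) +
          ((ρ / (a n ^ ((2 : ℝ) + d * (1 - γ)) * (1 - γ)) * ∑' z : Zd d, p n z ^ γ : ℝ) :
            EReal)))
      atTop (𝓝 (⊤ : EReal)) := by
  have hc : 0 < ρ / (γ - 1) := div_pos hρ (by linarith)
  obtain ⟨M, a₀, hM⟩ := exists_half_dirichlet_bound d hγ hγd2 hc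
  rw [EReal.tendsto_nhds_top_iff_real]
  intro B
  rw [ENNReal.tendsto_nhds_top_iff_nnreal] at hS
  filter_upwards [hS (Real.toNNReal (2 * (B + M))), hatop.eventually_ge_atTop a₀] with n hn han
  have ha2 : 0 < a n ^ 2 := pow_pos (ha n) 2
  by_cases htop : dirS (p n) = ⊤
  · rw [htop, EReal.coe_ennreal_top, EReal.top_add_coe, EReal.coe_mul_top_of_pos ha2]
    exact EReal.coe_lt_top B
  have hb := hM (p n) (hp n) htop (a n) (ha n) han
  set s := (dirS (p n)).toReal with hs
  have hSs : dirS (p n) = ENNReal.ofReal s := (ENNReal.ofReal_toReal htop).symm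
  have hs0 : 0 ≤ s := ENNReal.toReal_nonneg
  have hn' : 2 * (B + M) < a n ^ 2 * s := by
    rw [hSs, ← ENNReal.ofReal_mul ha2.le] at hn
    exact (ENNReal.ofReal_lt_ofReal_iff'.1 hn).1
  rw [hSs, EReal.coe_ennreal_ofReal, max_eq_left hs0, ← EReal.coe_add, ← EReal.coe_mul,
    EReal.coe_lt_coe_iff]
  have hexp : a n ^ ((2 : ℝ) + d * (1 - γ)) * a n ^ (d * (γ - 1)) = a n ^ 2 := by
    rw [← Real.rpow_add (ha n), ← Real.rpow_two]
    congr 1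
    ring
  have hx : 0 < a n ^ ((2 : ℝ) + d * (1 - γ)) := Real.rpow_pos_of_pos (ha n) _
  have heq : a n ^ 2 * (ρ / (a n ^ ((2 : ℝ) + d * (1 - γ)) * (1 - γ)) * ∑' z, p n z ^ γ) =
      -(ρ / (γ - 1) * a n ^ (d * (γ - 1)) * ∑' z, p n z ^ γ) := by
    have h1 : 1 - γ ≠ 0 := by linarith
    have h2 : γ - 1 ≠ 0 := by linarith
    rw [← hexp, show γ - 1 = -(1 - γ) by ring]
    field_simp
  rw [mul_add, heq]
  linarith
end
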